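/- There exists a constant c = 2^{-13} such that for all sufficiently large n, if M_n is drawn uniformly at random from all n × n symmetric matrices with entries in {-1, 1}, then the probability that det(M_n) = 0 is at most exp(-c·√(n·log n)). -/

import Mathlib

/-- `symPr n E` is the probability that a uniformly random `n × n` symmetric matrix
with entries in `{-1, 1}` lies in the event `E`. -/
noncomputable def symPr (n : ℕ) (E : Set (Matrix (Fin n) (Fin n) ℤ)) : ℝ :=
  (Nat.card {A : Matrix (Fin n) (Fin n) ℤ |
      (A.IsSymm ∧ ∀ i j, A i j = 1 ∨ A i j = -1) ∧ A ∈ E} : ℝ) /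
  (Nat.card {A : Matrix (Fin n) (Fin n) ℤ |
      A.IsSymm ∧ ∀ i j, A i j = 1 ∨ A i j = -1} : ℝ)

namespace SymmetricSign

open Finset
open scoped BigOperators Pointwise

section Characters

variable {p : ℕ} [Fact p.Prime]

/-- `1 - cos (2πx/p)`. -/
noncomputable def deficit (x : ZMod p) : ℝ := 1 - (ZMod.stdAddChar x : ℂ).re

lemma norm_stdAddChar (x : ZMod p) : ‖(ZMod.stdAddChar x : ℂ)‖ = 1 := AddChar.norm_apply _ _

lemma two_mul_deficit (x : ZMod p) : 2 * deficit x = ‖(ZMod.stdAddChar x : ℂ) - 1‖ ^ 2 := by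
  have h1 : ‖(ZMod.stdAddChar x : ℂ)‖ ^ 2 = 1 := by rw [norm_stdAddChar]; norm_num
  rw [← Complex.normSq_eq_norm_sq, Complex.normSq_apply] at h1 ⊢
  simp only [Complex.sub_re, Complex.one_re, Complex.sub_im, Complex.one_im, deficit]
  linarith

lemma deficit_nonneg (x : ZMod p) : 0 ≤ deficit x := by
  have := two_mul_deficit x
  have := sq_nonneg ‖(ZMod.stdAddChar x : ℂ) - 1‖
  linarith

lemma abs_re_stdAddChar_le (x : ZMod p) : |(ZMod.stdAddChar x : ℂ).re| ≤ 1 :=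
  (Complex.abs_re_le_norm _).trans (norm_stdAddChar x).le

lemma deficit_le_two (x : ZMod p) : deficit x ≤ 2 := by
  have := (abs_le.1 (abs_re_stdAddChar_le x)).1
  unfold deficit; linarith

@[simp] lemma deficit_zero : deficit (0 : ZMod p) = 0 := by simp [deficit]

lemma deficit_add_le (x y : ZMod p) : deficit (x + y) ≤ 2 * deficit x + 2 * deficit y := by
  have hx := two_mul_deficit x
  have hy := two_mul_deficit y
  have hxy := two_mul_deficit (x + y)
  have h : ‖(ZMod.stdAddChar (x + y) : ℂ) - 1‖ ≤
      ‖(ZMod.stdAddChar x : ℂ) - 1‖ + ‖(ZMod.stdAddChar y : ℂ) - 1‖ := by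
    have e : (ZMod.stdAddChar (x + y) : ℂ) - 1 =
        ZMod.stdAddChar x * (ZMod.stdAddChar y - 1) + (ZMod.stdAddChar x - 1) := by
      rw [AddChar.map_add_eq_mul]; ring
    rw [e]
    refine (norm_add_le _ _).trans ?_
    rw [norm_mul, norm_stdAddChar]; linarith
  have h0 := norm_nonneg ((ZMod.stdAddChar (x + y) : ℂ) - 1)
  nlinarith [sq_nonneg (‖(ZMod.stdAddChar x : ℂ) - 1‖ - ‖(ZMod.stdAddChar y : ℂ) - 1‖)]

lemma deficit_two_mul (x : ZMod p) :
    deficit (2 * x) = 2 - 2 * (ZMod.stdAddChar x : ℂ).re ^ 2 := by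
  have h1 : ‖(ZMod.stdAddChar x : ℂ)‖ ^ 2 = 1 := by rw [norm_stdAddChar]; norm_num
  rw [← Complex.normSq_eq_norm_sq, Complex.normSq_apply] at h1
  simp only [deficit, two_mul, AddChar.map_add_eq_mul, Complex.mul_re]
  linarith

lemma abs_re_stdAddChar_le_exp (x : ZMod p) :
    |(ZMod.stdAddChar x : ℂ).re| ≤ Real.exp (-deficit (2 * x) / 4) := by
  rw [deficit_two_mul]
  refine abs_le_of_sq_le_sq ?_ (Real.exp_pos _).le
  rw [← Real.exp_nat_mul]
  have := Real.add_one_le_exp ((ZMod.stdAddChar x : ℂ).re ^ 2 - 1)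
  refine (le_of_eq (by ring)).trans (this.trans (Real.exp_le_exp.2 (le_of_eq ?_)))
  push_cast; ring

lemma sum_stdAddChar_mul (x : ZMod p) :
    ∑ ξ : ZMod p, (ZMod.stdAddChar (ξ * x) : ℂ) = if x = 0 then (p : ℂ) else 0 := by
  rw [AddChar.sum_mulShift x (ZMod.isPrimitive_stdAddChar p)]
  split_ifs <;> simp [ZMod.card]

lemma p_pos : (0 : ℝ) < p := by exact_mod_cast (Fact.out : p.Prime).pos

lemma sum_deficit_mul {x : ZMod p} (hx : x ≠ 0) : ∑ ξ : ZMod p, deficit (ξ * x) = p := by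
  have h := congrArg Complex.re (sum_stdAddChar_mul x)
  rw [if_neg hx, Complex.re_sum] at h
  simp only [deficit, sum_sub_distrib, h]
  simp [ZMod.card]

lemma expect_zmod (f : ZMod p → ℝ) : 𝔼 ξ, f ξ = (∑ ξ, f ξ) / p := by
  rw [Fintype.expect_eq_sum_div_card, ZMod.card]

variable {ι : Type*}

/-- The energy at frequency `ξ` of the coordinates of `v` in `S`. -/
noncomputable def energy (v : ι → ZMod p) (S : Finset ι) (ξ : ZMod p) : ℝ :=
  ∑ i ∈ S, deficit (ξ * v i)

/-- A Fourier-analytic upper bound for the concentration of the random signed sum of the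
coordinates of `v` in `S`. -/
noncomputable def conc (v : ι → ZMod p) (S : Finset ι) : ℝ :=
  𝔼 ξ : ZMod p, Real.exp (-energy v S ξ / 4)

/-- The mass at `x` of the (signed) measure whose mass at the origin is `conc v S`. -/
noncomputable def concAt (v : ι → ZMod p) (S : Finset ι) (x : ZMod p) : ℝ :=
  𝔼 ξ : ZMod p, Real.exp (-energy v S ξ / 4) * (ZMod.stdAddChar (ξ * x) : ℂ).re

open Classical in
/-- The points of mass at least half the mass at the origin. -/
noncomputable def nbhd (v : ι → ZMod p) (S : Finset ι) : Finset (ZMod p) :=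
  univ.filter fun x => conc v S / 2 ≤ concAt v S x

lemma mem_nbhd {v : ι → ZMod p} {S : Finset ι} {x : ZMod p} :
    x ∈ nbhd v S ↔ conc v S / 2 ≤ concAt v S x := by simp [nbhd]

lemma energy_nonneg (v : ι → ZMod p) (S : Finset ι) (ξ : ZMod p) : 0 ≤ energy v S ξ :=
  sum_nonneg fun _ _ => deficit_nonneg _

lemma energy_mono (v : ι → ZMod p) {S T : Finset ι} (h : S ⊆ T) (ξ : ZMod p) :
    energy v S ξ ≤ energy v T ξ :=
  sum_le_sum_of_subset_of_nonneg h fun _ _ _ => deficit_nonneg _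

lemma energy_congr {v w : ι → ZMod p} {S : Finset ι} (h : ∀ i ∈ S, v i = w i) :
    energy v S = energy w S := by
  funext ξ; exact sum_congr rfl fun i hi => by rw [h i hi]

lemma conc_congr {v w : ι → ZMod p} {S : Finset ι} (h : ∀ i ∈ S, v i = w i) :
    conc v S = conc w S := by simp only [conc, energy_congr h]

lemma nbhd_congr {v w : ι → ZMod p} {S : Finset ι} (h : ∀ i ∈ S, v i = w i) :
    nbhd v S = nbhd w S := by
  ext x; simp only [mem_nbhd, conc, concAt, energy_congr h]

lemma conc_mono (v : ι → ZMod p) {S T : Finset ι} (h : S ⊆ T) : conc v T ≤ conc v S := by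
  refine expect_le_expect fun ξ _ => Real.exp_le_exp.2 ?_
  have := energy_mono v h ξ
  linarith

@[simp] lemma conc_empty (v : ι → ZMod p) : conc v ∅ = 1 := by
  simp [conc, energy]

lemma conc_le_one (v : ι → ZMod p) (S : Finset ι) : conc v S ≤ 1 :=
  (conc_mono v (empty_subset S)).trans (conc_empty v).le

lemma conc_pos (v : ι → ZMod p) (S : Finset ι) : 0 < conc v S :=
  expect_pos (fun _ _ => Real.exp_pos _) univ_nonempty

lemma mem_nbhd_of_eq_zero (v : ι → ZMod p) (S : Finset ι) : (0 : ZMod p) ∈ nbhd v S := by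
  have h : concAt v S 0 = conc v S := by simp [concAt, conc]
  rw [mem_nbhd, h]
  linarith [conc_pos v S]

lemma mem_nbhd_empty {v : ι → ZMod p} {x : ZMod p} (h : x ∈ nbhd v ∅) : x = 0 := by
  by_contra hx
  rw [mem_nbhd, conc_empty, concAt, expect_zmod] at h
  have h' := congrArg Complex.re (sum_stdAddChar_mul x)
  rw [if_neg hx, Complex.re_sum] at h'
  simp [energy] at h'  h
  rw [h'] at h
  norm_num at h

lemma exp_neg_quarter_le {t : ℝ} (h0 : 0 ≤ t) (h2 : t ≤ 2) : Real.exp (-t / 4) ≤ 1 - t / 8 := by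
  have h := Real.add_one_le_exp (t / 4)
  rw [neg_div, Real.exp_neg]
  refine (inv_anti₀ (by linarith) h).trans ?_
  rw [inv_le_iff_one_le_mul₀ (by linarith)]
  nlinarith

lemma conc_insert_le [DecidableEq ι] {v : ι → ZMod p} {S : Finset ι} {x : ι} (hx : x ∉ S)
    (hN : v x ∉ nbhd v S) : conc v (insert x S) ≤ 15 / 16 * conc v S := by
  rw [mem_nbhd, not_le] at hN
  have h : conc v (insert x S) ≤ 7 / 8 * conc v S + 1 / 8 * concAt v S (v x) := by
    unfold conc concAt
    rw [mul_expect, mul_expect, ← expect_add_distrib]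
    refine expect_le_expect fun ξ _ => ?_
    have e : energy v (insert x S) ξ = deficit (ξ * v x) + energy v S ξ := sum_insert hx
    rw [e, show -(deficit (ξ * v x) + energy v S ξ) / 4 =
      -energy v S ξ / 4 + -deficit (ξ * v x) / 4 by ring, Real.exp_add]
    have h1 := exp_neg_quarter_le (deficit_nonneg (ξ * v x)) (deficit_le_two _)
    have h2 := Real.exp_pos (-energy v S ξ / 4)
    refine (mul_le_mul_of_nonneg_left h1 h2.le).trans (le_of_eq ?_)
    unfold deficit; ring
  linarith

lemma conc_singleton_le {v : ι → ZMod p} {x : ι} (hx : v x ≠ 0) : conc v {x} ≤ 15 / 16 := by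
  classical
  have := conc_insert_le (v := v) (S := ∅) (x := x) (by simp) fun h => hx (mem_nbhd_empty h)
  simpa using this

/-- Parseval's inequality for the real parts of the Fourier coefficients. -/
lemma sum_sq_expect_re_le (f : ZMod p → ℝ) :
    ∑ x : ZMod p, (𝔼 ξ, f ξ * (ZMod.stdAddChar (ξ * x) : ℂ).re) ^ 2 ≤ 𝔼 ξ, f ξ ^ 2 := by
  have hp := p_pos (p := p)
  have key : ∑ x : ZMod p, ‖∑ ξ, (f ξ : ℂ) * ZMod.stdAddChar (ξ * x)‖ ^ 2 =
      p * ∑ ξ, f ξ ^ 2 := by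
    have h : ∀ x : ZMod p, ((‖∑ ξ, (f ξ : ℂ) * ZMod.stdAddChar (ξ * x)‖ ^ 2 : ℝ) : ℂ) =
        ∑ ξ, ∑ η, (f ξ : ℂ) * f η * ZMod.stdAddChar (x * (ξ - η)) := by
      intro x
      rw [Complex.ofReal_pow, ← Complex.mul_conj', map_sum, sum_mul_sum]
      refine sum_congr rfl fun ξ _ => sum_congr rfl fun η _ => ?_
      rw [map_mul (starRingEnd ℂ), ← AddChar.map_neg_eq_conj, Complex.conj_ofReal,
        show x * (ξ - η) = ξ * x + -(η * x) by ring, AddChar.map_add_eq_mul]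
      ring
    have h2 : ((∑ x : ZMod p, ‖∑ ξ, (f ξ : ℂ) * ZMod.stdAddChar (ξ * x)‖ ^ 2 : ℝ) : ℂ) =
        ((p * ∑ ξ, f ξ ^ 2 : ℝ) : ℂ) := by
      rw [Complex.ofReal_sum, sum_congr rfl fun x _ => h x, sum_comm]
      push_cast
      rw [mul_sum]
      refine sum_congr rfl fun ξ _ => ?_
      rw [sum_comm, sum_eq_single ξ]
      · rw [← mul_sum, sum_stdAddChar_mul]; simp; ring
      · intro η _ hη
        rw [← mul_sum, sum_stdAddChar_mul, if_neg (sub_ne_zero.2 hη.symm), mul_zero]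
      · simp
    exact_mod_cast h2
  have h3 : ∀ x : ZMod p, (𝔼 ξ, f ξ * (ZMod.stdAddChar (ξ * x) : ℂ).re) ^ 2 ≤
      ‖∑ ξ, (f ξ : ℂ) * ZMod.stdAddChar (ξ * x)‖ ^ 2 / p ^ 2 := by
    intro x
    rw [expect_zmod, div_pow]
    have e : ∑ ξ, f ξ * (ZMod.stdAddChar (ξ * x) : ℂ).re =
        (∑ ξ, (f ξ : ℂ) * ZMod.stdAddChar (ξ * x)).re := by
      rw [Complex.re_sum]; simp
    rw [e]
    refine div_le_div_of_nonneg_right ?_ (sq_nonneg _)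
    rw [← sq_abs]
    exact pow_le_pow_left₀ (abs_nonneg _) (Complex.abs_re_le_norm _) 2
  refine (sum_le_sum fun x _ => h3 x).trans (le_of_eq ?_)
  rw [← sum_div, key, expect_zmod]
  field_simp

lemma card_nbhd_mul_conc_le (v : ι → ZMod p) (S : Finset ι) :
    #(nbhd v S) * conc v S ≤ 4 := by
  have h1 : #(nbhd v S) * (conc v S / 2) ^ 2 ≤ conc v S := by
    calc #(nbhd v S) * (conc v S / 2) ^ 2 = ∑ x ∈ nbhd v S, (conc v S / 2) ^ 2 := by
          rw [sum_const, nsmul_eq_mul]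
      _ ≤ ∑ x ∈ nbhd v S, concAt v S x ^ 2 := by
          refine sum_le_sum fun x hx => ?_
          have := mem_nbhd.1 hx
          have := conc_pos v S
          gcongr
      _ ≤ ∑ x, concAt v S x ^ 2 := sum_le_univ_sum_of_nonneg fun _ => sq_nonneg _
      _ ≤ 𝔼 ξ, Real.exp (-energy v S ξ / 4) ^ 2 := sum_sq_expect_re_le _
      _ ≤ conc v S := by
          refine expect_le_expect fun ξ _ => ?_
          have h0 := Real.exp_pos (-energy v S ξ / 4)
          have h1 : Real.exp (-energy v S ξ / 4) ≤ 1 :=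
            Real.exp_le_one_iff.2 (by linarith [energy_nonneg v S ξ])
          nlinarith
  have h2 := conc_pos v S
  have : (#(nbhd v S) * conc v S) * conc v S ≤ 4 * conc v S := by nlinarith
  exact le_of_mul_le_mul_right this h2

end Characters

section Concentration

variable {p : ℕ} [Fact p.Prime] {ι : Type*}

lemma conc_eq_expect_two_mul (hp2 : p ≠ 2) (v : ι → ZMod p) (S : Finset ι) :
    conc v S = 𝔼 ξ : ZMod p, Real.exp (-energy v S (2 * ξ) / 4) := by
  have h2 : (2 : ZMod p) ≠ 0 := Ring.two_ne_zero (by rwa [ZMod.ringChar_zmod_n])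
  exact (Fintype.expect_equiv (Equiv.mulLeft₀ (2 : ZMod p) h2) _ _ fun ξ => rfl).symm

lemma map_sum_stdAddChar {σ : Type*} (D : Finset σ) (f : σ → ZMod p) :
    (ZMod.stdAddChar (∑ s ∈ D, f s) : ℂ) = ∏ s ∈ D, (ZMod.stdAddChar (f s) : ℂ) := by
  classical
  induction D using Finset.induction_on with
  | empty => simp
  | insert a D ha ih => rw [sum_insert ha, prod_insert ha, AddChar.map_add_eq_mul, ih]

/-- Concentration of a linear form in independent signs. -/
lemma expect_sign_sum_eq_le {σ : Type*} [Fintype σ] [DecidableEq σ] (hp2 : p ≠ 2) (C : σ → ZMod p)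
    (D : Finset σ) (a : ZMod p) :
    𝔼 ω : σ → ℤˣ, (if ∑ s ∈ D, ((ω s : ℤ) : ZMod p) * C s = a then (1 : ℝ) else 0) ≤
      conc C D := by
  have hp := p_pos (p := p)
  have hpc : (p : ℂ) ≠ 0 := by exact_mod_cast hp.ne'
  have hprod : ∀ ξ : ZMod p, 𝔼 ω : σ → ℤˣ,
      (ZMod.stdAddChar (ξ * ∑ s ∈ D, ((ω s : ℤ) : ZMod p) * C s) : ℂ) =
        ∏ s ∈ D, ((ZMod.stdAddChar (ξ * C s) : ℂ).re : ℂ) := by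
    intro ξ
    have h1 : ∀ ω : σ → ℤˣ,
        (ZMod.stdAddChar (ξ * ∑ s ∈ D, ((ω s : ℤ) : ZMod p) * C s) : ℂ) =
          ∏ s, if s ∈ D then (ZMod.stdAddChar (ξ * (((ω s : ℤ) : ZMod p) * C s)) : ℂ) else 1 := by
      intro ω
      rw [prod_ite_mem, univ_inter, mul_sum]
      exact map_sum_stdAddChar _ _
    have h2 : ∑ ω : σ → ℤˣ, ∏ s, (if s ∈ D then
          (ZMod.stdAddChar (ξ * (((ω s : ℤ) : ZMod p) * C s)) : ℂ) else 1) =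
        ∏ s, ∑ u : ℤˣ, if s ∈ D then
          (ZMod.stdAddChar (ξ * (((u : ℤ) : ZMod p) * C s)) : ℂ) else 1 := by
      rw [prod_univ_sum, Fintype.piFinset_univ]
    have h3 : ∀ s, (∑ u : ℤˣ, if s ∈ D then
          (ZMod.stdAddChar (ξ * (((u : ℤ) : ZMod p) * C s)) : ℂ) else 1) =
        2 * (if s ∈ D then ((ZMod.stdAddChar (ξ * C s) : ℂ).re : ℂ) else 1) := by
      intro s
      rw [show (univ : Finset ℤˣ) = {1, -1} from rfl, sum_pair (by decide)]
      split_ifs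
      · simp only [Units.val_one, Int.cast_one, one_mul, Units.val_neg, Int.cast_neg, neg_mul,
          mul_neg, AddChar.map_neg_eq_conj, Complex.add_conj]
        push_cast; rfl
      · norm_num
    rw [Fintype.expect_eq_sum_div_card, sum_congr rfl fun ω _ => h1 ω, h2,
      prod_congr rfl fun s _ => h3 s, prod_mul_distrib, prod_ite_mem, univ_inter,
      Fintype.card_fun]
    simp
  have hind : ∀ y : ZMod p, (if y = a then (1 : ℂ) else 0) =
      𝔼 ξ : ZMod p, (ZMod.stdAddChar (ξ * y) : ℂ) * ZMod.stdAddChar (-(ξ * a)) := by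
    intro y
    have h1 : ∀ ξ : ZMod p, (ZMod.stdAddChar (ξ * y) : ℂ) * ZMod.stdAddChar (-(ξ * a)) =
        ZMod.stdAddChar (ξ * (y - a)) := by
      intro ξ
      rw [← AddChar.map_add_eq_mul]; ring_nf
    rw [Fintype.expect_eq_sum_div_card, sum_congr rfl fun ξ _ => h1 ξ, sum_stdAddChar_mul,
      ZMod.card]
    simp only [sub_eq_zero]
    split_ifs <;> simp [hpc]
  have hfourier : ((𝔼 ω : σ → ℤˣ,
      (if ∑ s ∈ D, ((ω s : ℤ) : ZMod p) * C s = a then (1 : ℝ) else 0) : ℝ) : ℂ) =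
      𝔼 ξ : ZMod p, (∏ s ∈ D, ((ZMod.stdAddChar (ξ * C s) : ℂ).re : ℂ)) *
        ZMod.stdAddChar (-(ξ * a)) := by
    have h1 : ((𝔼 ω : σ → ℤˣ,
      (if ∑ s ∈ D, ((ω s : ℤ) : ZMod p) * C s = a then (1 : ℝ) else 0) : ℝ) : ℂ) =
      𝔼 ω : σ → ℤˣ, (if ∑ s ∈ D, ((ω s : ℤ) : ZMod p) * C s = a then (1 : ℂ) else 0) := by
      rw [Fintype.expect_eq_sum_div_card, Fintype.expect_eq_sum_div_card]
      push_cast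
      simp only [apply_ite Complex.ofReal, Complex.ofReal_one, Complex.ofReal_zero]
    rw [h1, expect_congr rfl fun ω _ => hind _, expect_comm]
    refine expect_congr rfl fun ξ _ => ?_
    rw [← expect_mul, hprod]
  have hnorm : 𝔼 ω : σ → ℤˣ,
      (if ∑ s ∈ D, ((ω s : ℤ) : ZMod p) * C s = a then (1 : ℝ) else 0) ≤
      ‖𝔼 ξ : ZMod p, (∏ s ∈ D, ((ZMod.stdAddChar (ξ * C s) : ℂ).re : ℂ)) *
        (ZMod.stdAddChar (-(ξ * a)) : ℂ)‖ := by
    rw [← hfourier, Complex.norm_real]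
    exact le_abs_self _
  refine hnorm.trans ?_
  rw [conc_eq_expect_two_mul hp2, expect_zmod, Fintype.expect_eq_sum_div_card, ZMod.card,
    norm_div, Complex.norm_natCast]
  refine div_le_div_of_nonneg_right ((norm_sum_le _ _).trans (sum_le_sum fun ξ _ => ?_)) hp.le
  rw [norm_mul, norm_stdAddChar, mul_one, norm_prod, energy, neg_div, sum_div,
    ← sum_neg_distrib, Real.exp_sum]
  refine prod_le_prod (fun _ _ => norm_nonneg _) fun s _ => ?_
  rw [Complex.norm_real, mul_assoc, ← neg_div]
  exact abs_re_stdAddChar_le_exp _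

open Classical in
/-- The frequencies of energy at most `s`. -/
noncomputable def lowEnergy (v : ι → ZMod p) (S : Finset ι) (s : ℝ) : Finset (ZMod p) :=
  univ.filter fun ξ => energy v S ξ ≤ s

lemma mem_lowEnergy {v : ι → ZMod p} {S : Finset ι} {s : ℝ} {ξ : ZMod p} :
    ξ ∈ lowEnergy v S s ↔ energy v S ξ ≤ s := by simp [lowEnergy]

lemma zero_mem_lowEnergy (v : ι → ZMod p) (S : Finset ι) {s : ℝ} (hs : 0 ≤ s) :
    (0 : ZMod p) ∈ lowEnergy v S s := by
  simpa [mem_lowEnergy, energy] using hs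

lemma energy_add_le (v : ι → ZMod p) (S : Finset ι) (ξ η : ZMod p) :
    energy v S (ξ + η) ≤ 2 * energy v S ξ + 2 * energy v S η := by
  unfold energy
  rw [mul_sum, mul_sum, ← sum_add_distrib]
  refine sum_le_sum fun i _ => ?_
  rw [add_mul]
  exact deficit_add_le _ _

lemma card_lowEnergy_lt {v : ι → ZMod p} {S : Finset ι} (hv : ∃ x ∈ S, v x ≠ 0) {s : ℝ}
    (hs : s < 1) : #(lowEnergy v S s) < p := by
  by_contra hcon
  have hall : lowEnergy v S s = univ :=
    (card_eq_iff_eq_univ _).1 (le_antisymm (card_le_univ _) (by rw [ZMod.card]; omega))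
  obtain ⟨x, hx, hvx⟩ := hv
  have h1 : (p : ℝ) ≤ ∑ ξ, energy v S ξ := by
    rw [← sum_deficit_mul hvx]
    exact sum_le_sum fun ξ _ => single_le_sum (f := fun i => deficit (ξ * v i))
      (fun _ _ => deficit_nonneg _) hx
  have h2 : ∑ ξ, energy v S ξ ≤ p * s := by
    have := sum_le_card_nsmul univ (energy v S) s fun ξ _ =>
      mem_lowEnergy.1 (hall ▸ mem_univ ξ)
    simpa [ZMod.card] using this
  have := p_pos (p := p)
  nlinarith

/-- Doubling of the low-energy sets, by the Cauchy–Davenport theorem. -/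
lemma two_mul_card_lowEnergy_le {v : ι → ZMod p} {S : Finset ι} (hv : ∃ x ∈ S, v x ≠ 0)
    {s : ℝ} (h0 : 0 ≤ s) (hs : 4 * s < 1) :
    2 * ((#(lowEnergy v S s) : ℝ) - 1) ≤ (#(lowEnergy v S (4 * s)) : ℝ) - 1 := by
  have hne : (lowEnergy v S s).Nonempty := ⟨0, zero_mem_lowEnergy v S h0⟩
  have hcd := ZMod.cauchy_davenport (Fact.out : p.Prime) hne hne
  have hsub : lowEnergy v S s + lowEnergy v S s ⊆ lowEnergy v S (4 * s) := by
    intro x hx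
    obtain ⟨a, ha, b, hb, rfl⟩ := mem_add.1 hx
    rw [mem_lowEnergy] at *
    linarith [energy_add_le v S a b]
  have hlt := card_lowEnergy_lt hv hs
  have hle := card_le_card hsub
  have hpos := hne.card_pos
  have : 2 * #(lowEnergy v S s) ≤ #(lowEnergy v S (4 * s)) + 1 := by omega
  have : (2 * #(lowEnergy v S s) : ℝ) ≤ #(lowEnergy v S (4 * s)) + 1 := by exact_mod_cast this
  linarith

lemma card_lowEnergy_iterate {v : ι → ZMod p} {S : Finset ι} (hv : ∃ x ∈ S, v x ≠ 0) (l : ℕ) :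
    2 ^ l * ((#(lowEnergy v S (1 / 2 / 4 ^ l)) : ℝ) - 1) ≤ #(lowEnergy v S (1 / 2)) := by
  have h : ∀ l : ℕ, 2 ^ l * ((#(lowEnergy v S (1 / 2 / 4 ^ l)) : ℝ) - 1) ≤
      #(lowEnergy v S (1 / 2)) - 1 := by
    intro l
    induction l with
    | zero => simp
    | succ l ih =>
      have e : 4 * (1 / 2 / 4 ^ (l + 1) : ℝ) = 1 / 2 / 4 ^ l := by field_simp; ring
      have h4 : (1 : ℝ) ≤ 4 ^ l := one_le_pow₀ (by norm_num)
      have := two_mul_card_lowEnergy_le hv (s := 1 / 2 / 4 ^ (l + 1)) (by positivity) (by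
        rw [e, div_lt_one (by positivity)]; linarith)
      rw [e] at this
      rw [pow_succ, mul_assoc]
      exact (mul_le_mul_of_nonneg_left this (by positivity)).trans ih
  linarith [h l]

/-- Replicating a nonzero block `16 ^ l` times lowers its concentration by a factor `2 ^ l`. -/
lemma expect_exp_energy_pow_le {v : ι → ZMod p} {S : Finset ι} (hv : ∃ x ∈ S, v x ≠ 0) (l : ℕ) :
    𝔼 ξ, Real.exp (-(16 ^ l * energy v S ξ) / 4) ≤ 1 / p + 10 / 2 ^ l * conc v S := by
  have hp := p_pos (p := p)
  set A := lowEnergy v S (1 / 2 / 4 ^ l) with hA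
  set H := ∑ ξ, Real.exp (-energy v S ξ / 4) with hH
  have hconc : conc v S = H / p := by rw [conc, expect_zmod]
  have hhalf : (#(lowEnergy v S (1 / 2)) : ℝ) ≤ 2 * H := by
    have h1 : (#(lowEnergy v S (1 / 2)) : ℝ) * (1 / 2) ≤
        ∑ ξ ∈ lowEnergy v S (1 / 2), Real.exp (-energy v S ξ / 4) := by
      rw [← nsmul_eq_mul]
      refine card_nsmul_le_sum _ _ _ fun ξ hξ => ?_
      have h2 := mem_lowEnergy.1 hξ
      have h3 := Real.add_one_le_exp (-energy v S ξ / 4)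
      linarith
    have h2 : ∑ ξ ∈ lowEnergy v S (1 / 2), Real.exp (-energy v S ξ / 4) ≤ H :=
      sum_le_univ_sum_of_nonneg fun _ => (Real.exp_pos _).le
    linarith
  have h2l : (0 : ℝ) < 2 ^ l := by positivity
  have hAcard : (#A : ℝ) ≤ 1 + 2 / 2 ^ l * H := by
    have h1 := card_lowEnergy_iterate hv l
    have h2 : 2 ^ l * ((#A : ℝ) - 1) ≤ 2 * H := h1.trans hhalf
    have h3 : (#A : ℝ) - 1 ≤ 2 * H / 2 ^ l := by rw [le_div_iff₀ h2l]; linarith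
    have : 2 * H / 2 ^ l = 2 / 2 ^ l * H := by ring
    linarith
  have hin : ∑ ξ ∈ A, Real.exp (-(16 ^ l * energy v S ξ) / 4) ≤ #A := by
    have := sum_le_card_nsmul A (fun ξ => Real.exp (-(16 ^ l * energy v S ξ) / 4)) 1 fun ξ _ => by
      have := energy_nonneg v S ξ
      refine Real.exp_le_one_iff.2 ?_
      have : 0 ≤ 16 ^ l * energy v S ξ := by positivity
      linarith
    simpa using this
  have hout : ∑ ξ ∈ Aᶜ, Real.exp (-(16 ^ l * energy v S ξ) / 4) ≤ 8 / 2 ^ l * H := by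
    calc ∑ ξ ∈ Aᶜ, Real.exp (-(16 ^ l * energy v S ξ) / 4)
        ≤ ∑ ξ ∈ Aᶜ, 8 / 2 ^ l * Real.exp (-energy v S ξ / 4) := by
          refine sum_le_sum fun ξ hξ => ?_
          rw [mem_compl, hA, mem_lowEnergy, not_le] at hξ
          rw [show -(16 ^ l * energy v S ξ) / 4 =
            -((16 ^ l - 1) * energy v S ξ / 4) + -energy v S ξ / 4 by ring, Real.exp_add]
          refine mul_le_mul_of_nonneg_right ?_ (Real.exp_pos _).le
          have h16 : (16 : ℝ) ^ l = 4 ^ l * 4 ^ l := by rw [← mul_pow]; norm_num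
          have h4 : (4 : ℝ) ^ l = 2 ^ l * 2 ^ l := by rw [← mul_pow]; norm_num
          have h1 : (1 : ℝ) ≤ 2 ^ l := one_le_pow₀ (by norm_num)
          have h4' : (1 : ℝ) ≤ 4 ^ l := one_le_pow₀ (by norm_num)
          have hE : 1 / 2 ≤ 4 ^ l * energy v S ξ := by
            rw [div_lt_iff₀ (by positivity)] at hξ; linarith
          have h5 : (2 ^ l - 1) / 8 ≤ (16 ^ l - 1) * energy v S ξ / 4 := by
            rw [h16]
            have h6 := energy_nonneg v S ξ
            have : (4 ^ l - 1) * (1 / 2) ≤ (4 ^ l * 4 ^ l - 1) * energy v S ξ := by nlinarith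
            nlinarith
          have h6 := Real.add_one_le_exp ((16 ^ l - 1) * energy v S ξ / 4)
          rw [Real.exp_neg, inv_le_comm₀ (Real.exp_pos _) (by positivity), inv_div]
          linarith
      _ = 8 / 2 ^ l * ∑ ξ ∈ Aᶜ, Real.exp (-energy v S ξ / 4) := by rw [mul_sum]
      _ ≤ 8 / 2 ^ l * H := by
          refine mul_le_mul_of_nonneg_left ?_ (by positivity)
          exact sum_le_univ_sum_of_nonneg fun _ => (Real.exp_pos _).le
  rw [expect_zmod, hconc, ← sum_add_sum_compl A]
  have : (1 + 2 / 2 ^ l * H + 8 / 2 ^ l * H) / p = 1 / p + 10 / 2 ^ l * (H / p) := by ring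
  rw [← this]
  exact div_le_div_of_nonneg_right (by linarith) hp.le

/-- A Halász-type inequality for the union of `16 ^ l` disjoint nonzero blocks. -/
lemma conc_biUnion_le [DecidableEq ι] {κ : Type*} {K : Finset κ} {l : ℕ} (hK : #K = 16 ^ l)
    {v : ι → ZMod p} {T : κ → Finset ι} (hdisj : (K : Set κ).PairwiseDisjoint T)
    (hv : ∀ i ∈ K, ∃ x ∈ T i, v x ≠ 0) {M : ℝ} (hM : ∀ i ∈ K, conc v (T i) ≤ M) :
    conc v (K.biUnion T) ≤ 1 / p + 10 / 2 ^ l * M := by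
  have hk : (0 : ℝ) < #K := by rw [hK]; positivity
  have hkk : ((#K : ℕ) : ℝ) = 16 ^ l := by rw [hK]; push_cast; rfl
  have h1 : ∀ ξ, Real.exp (-energy v (K.biUnion T) ξ / 4) ≤
      ∑ i ∈ K, (#K : ℝ)⁻¹ * Real.exp (-(16 ^ l * energy v (T i) ξ) / 4) := by
    intro ξ
    have h := convexOn_exp.map_sum_le (t := K) (w := fun _ => (#K : ℝ)⁻¹)
      (p := fun i => -(16 ^ l * energy v (T i) ξ) / 4) (fun _ _ => by positivity)
      (by rw [sum_const, nsmul_eq_mul, mul_inv_cancel₀ hk.ne']) (fun _ _ => Set.mem_univ _)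
    simp only [smul_eq_mul] at h
    refine le_trans (le_of_eq ?_) h
    congr 1
    rw [energy, sum_biUnion hdisj, neg_div, sum_div, ← sum_neg_distrib]
    refine sum_congr rfl fun i _ => ?_
    rw [hkk, ← energy]
    field_simp
  calc conc v (K.biUnion T)
      ≤ 𝔼 ξ, ∑ i ∈ K, (#K : ℝ)⁻¹ * Real.exp (-(16 ^ l * energy v (T i) ξ) / 4) :=
        expect_le_expect fun ξ _ => h1 ξ
    _ = ∑ i ∈ K, (#K : ℝ)⁻¹ * 𝔼 ξ, Real.exp (-(16 ^ l * energy v (T i) ξ) / 4) := by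
        rw [expect_sum_comm]
        exact sum_congr rfl fun i _ => (mul_expect _ _ _).symm
    _ ≤ ∑ i ∈ K, (#K : ℝ)⁻¹ * (1 / p + 10 / 2 ^ l * M) := by
        refine sum_le_sum fun i hi => mul_le_mul_of_nonneg_left ?_ (by positivity)
        refine (expect_exp_energy_pow_le (hv i hi) l).trans ?_
        have := hM i hi
        gcongr
    _ = 1 / p + 10 / 2 ^ l * M := by
        rw [sum_const, nsmul_eq_mul, ← mul_assoc, mul_inv_cancel₀ hk.ne', one_mul]

end Concentration

section Probability

variable {Ω : Type*} [Fintype Ω]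

open Classical in
/-- The probability of `A` under the uniform measure on `Ω`. -/
noncomputable def prob (A : Ω → Prop) : ℝ := 𝔼 ω, if A ω then 1 else 0

lemma prob_nonneg (A : Ω → Prop) : 0 ≤ prob A :=
  expect_nonneg fun ω _ => by split_ifs <;> norm_num

lemma prob_mono {A B : Ω → Prop} (h : ∀ ω, A ω → B ω) : prob A ≤ prob B := by
  refine expect_le_expect fun ω _ => ?_
  split_ifs with h1 h2
  · exact le_rfl
  · exact absurd (h ω h1) h2
  · norm_num
  · exact le_rfl

lemma prob_congr {A B : Ω → Prop} (h : ∀ ω, A ω ↔ B ω) : prob A = prob B := by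
  rw [funext fun ω => propext (h ω)]

lemma prob_le_one [Nonempty Ω] (A : Ω → Prop) : prob A ≤ 1 := by
  refine (expect_le_expect (g := fun _ => (1 : ℝ)) fun ω _ => ?_).trans ?_
  · split_ifs <;> norm_num
  · rw [expect_const univ_nonempty]

lemma prob_or_le (A B : Ω → Prop) : prob (fun ω => A ω ∨ B ω) ≤ prob A + prob B := by
  unfold prob
  rw [← expect_add_distrib]
  refine expect_le_expect fun ω _ => ?_
  by_cases hA : A ω <;> by_cases hB : B ω <;> simp [hA, hB]

lemma prob_exists_le {κ : Type*} (K : Finset κ) (A : κ → Ω → Prop) :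
    prob (fun ω => ∃ i ∈ K, A i ω) ≤ ∑ i ∈ K, prob (A i) := by
  classical
  induction K using Finset.induction_on with
  | empty => simp [prob]
  | insert a K ha ih =>
    rw [sum_insert ha]
    calc prob (fun ω => ∃ i ∈ insert a K, A i ω)
        = prob (fun ω => A a ω ∨ ∃ i ∈ K, A i ω) := prob_congr fun ω => by simp
      _ ≤ _ := (prob_or_le _ _).trans (by linarith)

open Classical in
lemma prob_exists_and_le {κ : Type*} [Fintype κ] (D : κ → Prop) (A : κ → Ω → Prop) :
    prob (fun ω => ∃ i, D i ∧ A i ω) ≤ ∑ i with D i, prob (A i) := by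
  refine le_trans (le_of_eq (prob_congr fun ω => ?_)) (prob_exists_le _ _)
  simp

/-- A union bound in which the vectors are grouped into classes indexed by `C`. -/
lemma prob_exists_and_le_card_mul {κ τ : Type*} [Fintype κ] {D : κ → Prop} {A : κ → Ω → Prop}
    (C : Finset τ) (W : τ → κ → ℝ) {B : ℝ} (hW : ∀ c i, 0 ≤ W c i)
    (hD : ∀ i, D i → ∃ c ∈ C, prob (A i) ≤ W c i) (hB : ∀ c ∈ C, ∑ i, W c i ≤ B) :
    prob (fun ω => ∃ i, D i ∧ A i ω) ≤ #C * B := by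
  classical
  calc prob (fun ω => ∃ i, D i ∧ A i ω) ≤ ∑ i with D i, prob (A i) := prob_exists_and_le D A
    _ ≤ ∑ i with D i, ∑ c ∈ C, W c i := by
        refine sum_le_sum fun i hi => ?_
        obtain ⟨c, hc, h⟩ := hD i (mem_filter.1 hi).2
        exact h.trans (single_le_sum (f := fun c => W c i) (fun c _ => hW c i) hc)
    _ ≤ ∑ i, ∑ c ∈ C, W c i :=
        sum_le_univ_sum_of_nonneg fun i => sum_nonneg fun c _ => hW c i
    _ = ∑ c ∈ C, ∑ i, W c i := sum_comm
    _ ≤ #C * B := by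
        rw [← nsmul_eq_mul]
        exact sum_le_card_nsmul _ _ _ hB

end Probability

section Resampling

variable {σ τ α : Type*} [Fintype σ] [Fintype τ] [DecidableEq σ] [DecidableEq τ] [Fintype α]
  [Nonempty α]

lemma expect_comp_injective {e : σ → τ} (he : Function.Injective e) (f : (σ → α) → ℝ) :
    𝔼 ω : τ → α, f (ω ∘ e) = 𝔼 ω : σ → α, f ω := by
  classical
  let r : σ ≃ {x // x ∈ Set.range e} := Equiv.ofInjective e he
  let F : (τ → α) ≃ (σ → α) × ({x // ¬ x ∈ Set.range e} → α) :=
    (Equiv.piEquivPiSubtypeProd (fun x => x ∈ Set.range e) fun _ => α).trans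
      (Equiv.prodCongr (Equiv.arrowCongr r.symm (Equiv.refl α)) (Equiv.refl _))
  rw [Fintype.expect_equiv F (fun ω : τ → α => f (ω ∘ e)) (fun x => f x.1) fun ω => rfl,
    ← univ_product_univ, expect_product]
  exact expect_congr rfl fun ω _ => expect_const univ_nonempty (f ω)

lemma expect_eval (a : τ) (f : α → ℝ) : 𝔼 ω : τ → α, f (ω a) = 𝔼 b, f b := by
  rw [← Fintype.expect_equiv (Equiv.funUnique Unit α) (fun ω => f (ω ())) f fun ω => rfl]
  exact expect_comp_injective (e := fun _ : Unit => a) (fun _ _ _ => rfl)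
    fun ω : Unit → α => f (ω ())

lemma expect_resample (E : Finset σ) (f : (σ → α) → ℝ) :
    𝔼 ω : σ → α, f ω = 𝔼 ω : σ → α, 𝔼 ω' : σ → α, f (E.piecewise ω' ω) := by
  have hinv : Function.Involutive fun x : (σ → α) × (σ → α) =>
      (E.piecewise x.2 x.1, E.piecewise x.1 x.2) := by
    rintro ⟨x, y⟩
    ext s <;> by_cases hs : s ∈ E <;> simp [hs]
  have h := Fintype.expect_equiv hinv.toPerm
    (fun x : (σ → α) × (σ → α) => f (E.piecewise x.2 x.1)) (fun x => f x.1) fun x => rfl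
  rw [← univ_product_univ, expect_product, expect_product] at h
  rw [h]
  exact expect_congr rfl fun ω _ => (expect_const univ_nonempty _).symm

lemma prob_and_le_mul {E : Finset σ} {A B : (σ → α) → Prop} {ρ : ℝ}
    (hA : ∀ ω ω', A (E.piecewise ω' ω) ↔ A ω)
    (hB : ∀ ω, A ω → prob (fun ω' => B (E.piecewise ω' ω)) ≤ ρ) :
    prob (fun ω => A ω ∧ B ω) ≤ ρ * prob A := by
  classical
  unfold prob
  rw [expect_resample E, mul_expect]
  refine expect_le_expect fun ω _ => ?_
  by_cases h : A ω
  · simpa [hA, h, prob] using hB ω h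
  · simp [hA, h]

lemma prob_le_of_resample {E : Finset σ} {B : (σ → α) → Prop} {ρ : ℝ}
    (hB : ∀ ω, prob (fun ω' => B (E.piecewise ω' ω)) ≤ ρ) : prob B ≤ ρ := by
  have h := prob_and_le_mul (E := E) (A := fun _ : σ → α => True) (B := B) (ρ := ρ)
    (fun _ _ => Iff.rfl) fun ω _ => hB ω
  have h1 : prob (fun _ : σ → α => True) = 1 := by
    simp [prob, expect_const univ_nonempty]
  rw [h1, mul_one] at h
  exact le_trans (le_of_eq (prob_congr fun ω => by simp)) h

/-- The second moment bound for decoupling by partial resampling. -/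
lemma sq_prob_le_resample (E : Finset σ) (B : (σ → α) → Prop) :
    prob B ^ 2 ≤ 𝔼 ω : σ → α, prob (fun ω' => B ω ∧ B (E.piecewise ω' ω)) := by
  classical
  let g : (σ → α) → ℝ := fun ω => prob fun ω' => B (E.piecewise ω' ω)
  have hg : ∀ ω ω', g (E.piecewise ω' ω) = g ω := fun ω ω' =>
    prob_congr fun ω'' => by rw [piecewise_idem_right]
  have h1 : prob B = 𝔼 ω, g ω := expect_resample E _
  have h2 : (𝔼 ω, g ω) ^ 2 ≤ 𝔼 ω, g ω ^ 2 := by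
    have := expect_mul_sq_le_sq_mul_sq univ (fun _ : σ → α => (1 : ℝ)) g
    simpa [expect_const univ_nonempty] using this
  have h3 : 𝔼 ω, (if B ω then 1 else 0) * g ω = 𝔼 ω, g ω ^ 2 := by
    rw [expect_resample E]
    refine expect_congr rfl fun ω _ => ?_
    simp only [hg]
    rw [← expect_mul, sq]
    rfl
  rw [h1]
  refine h2.trans (h3 ▸ expect_le_expect fun ω _ => ?_)
  by_cases h : B ω
  · simp [h, g]
  · simp [h, prob_nonneg]

/-- Summation of a product of weights in order of increasing rank. -/
lemma sum_prod_le_prod {w : σ → (σ → α) → ℝ} (rank : σ → ℕ) (c : σ → ℝ)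
    (hw : ∀ y v, 0 ≤ w y v)
    (hdep : ∀ y x v a, x ≠ y → rank y ≤ rank x → w y (Function.update v x a) = w y v)
    (hsum : ∀ y v, ∑ a, w y (Function.update v y a) ≤ c y) :
    ∑ v, ∏ y, w y v ≤ ∏ y, c y := by
  have hc : ∀ y, 0 ≤ c y := fun y =>
    (sum_nonneg fun a _ => hw y _).trans (hsum y fun _ => Classical.arbitrary α)
  have hq : (0 : ℝ) < Fintype.card α := by exact_mod_cast Fintype.card_pos
  have key : ∀ S : Finset σ,
      𝔼 v : σ → α, ∏ y ∈ S, w y v ≤ ∏ y ∈ S, (c y / Fintype.card α) := by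
    intro S
    induction S using Finset.induction_on_max_value rank with
    | empty => simp [expect_const univ_nonempty]
    | insert a S ha hmax ih =>
      rw [prod_insert ha, expect_resample {a}]
      calc 𝔼 v : σ → α, 𝔼 v' : σ → α, ∏ y ∈ insert a S, w y (({a} : Finset σ).piecewise v' v)
          = 𝔼 v : σ → α, (∏ y ∈ S, w y v) * 𝔼 b, w a (Function.update v a b) := by
            refine expect_congr rfl fun v _ => ?_
            rw [← expect_eval a fun b => w a (Function.update v a b), mul_expect]
            refine expect_congr rfl fun v' _ => ?_
            rw [piecewise_singleton, prod_insert ha, mul_comm]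
            congr 1
            refine prod_congr rfl fun y hy => hdep _ _ _ _ ?_ (hmax y hy)
            rintro rfl; exact ha hy
        _ ≤ 𝔼 v : σ → α, (∏ y ∈ S, w y v) * (c a / Fintype.card α) := by
            refine expect_le_expect fun v _ => mul_le_mul_of_nonneg_left ?_
              (prod_nonneg fun y _ => hw y v)
            rw [Fintype.expect_eq_sum_div_card]
            exact div_le_div_of_nonneg_right (hsum a v) hq.le
        _ ≤ _ := by
            rw [← expect_mul, mul_comm]
            exact mul_le_mul_of_nonneg_left ih (div_nonneg (hc a) hq.le)
  have h := key univ
  rw [prod_div_distrib, prod_const, Fintype.expect_eq_sum_div_card, card_univ,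
    Fintype.card_fun] at h
  push_cast at h
  exact (div_le_div_iff_of_pos_right (by positivity)).1 h

end Resampling

section Rows

variable {p : ℕ} [Fact p.Prime] {ι : Type*} [Fintype ι] [DecidableEq ι]

/-- The entries modulo `p` of the symmetric sign matrix with sign pattern `ω`. -/
def entry (p : ℕ) (ω : Sym2 ι → ℤˣ) (i j : ι) : ZMod p := ((ω s(i, j) : ℤ) : ZMod p)

/-- The `i`-th coordinate of the product of the matrix and `v`. -/
def rowSum {p : ℕ} (ω : Sym2 ι → ℤˣ) (v : ι → ZMod p) (i : ι) : ZMod p := ∑ j, entry p ω i j * v j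

/-- The coordinates of the entries `(r, u)` with `u ∈ U`. -/
def star (r : ι) (U : Finset ι) : Finset (Sym2 ι) := U.image fun u => s(r, u)

omit [Fintype ι] [DecidableEq ι] in
lemma mk_injective (r : ι) : Function.Injective fun u : ι => s(r, u) := by
  intro a b h
  exact Sym2.congr_right.1 h

omit [Fintype ι] in
lemma mk_mem_star_of_ne {r i j : ι} {U : Finset ι} (hir : i ≠ r) :
    s(i, j) ∈ star r U ↔ j = r ∧ i ∈ U := by
  simp only [star, mem_image, Sym2.eq_iff]
  constructor
  · rintro ⟨u, hu, ⟨h1, -⟩ | ⟨rfl, rfl⟩⟩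
    · exact absurd h1.symm hir
    · exact ⟨rfl, hu⟩
  · rintro ⟨rfl, hi⟩
    exact ⟨i, hi, Or.inr ⟨rfl, rfl⟩⟩

omit [Fintype ι] in
lemma mk_mem_star {r j : ι} {U : Finset ι} : s(r, j) ∈ star r U ↔ j ∈ U := by
  rw [star, mem_image]
  exact ⟨fun ⟨u, hu, h⟩ => mk_injective r h ▸ hu, fun h => ⟨j, h, rfl⟩⟩

omit [Fact p.Prime] [Fintype ι] in
lemma entry_piecewise_of_notMem {r i : ι} {U : Finset ι} (hir : i ≠ r) (hi : i ∉ U)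
    (ω ω' : Sym2 ι → ℤˣ) (j : ι) : entry p ((star r U).piecewise ω' ω) i j = entry p ω i j := by
  have : s(i, j) ∉ star r U := by rw [mk_mem_star_of_ne hir]; tauto
  simp [entry, this]

omit [Fact p.Prime] in
lemma rowSum_piecewise_of_notMem {r i : ι} {U : Finset ι} (hir : i ≠ r) (hi : i ∉ U)
    (ω ω' : Sym2 ι → ℤˣ) (v : ι → ZMod p) :
    rowSum ((star r U).piecewise ω' ω) v i = rowSum ω v i := by
  simp only [rowSum, entry_piecewise_of_notMem hir hi]

lemma rowSum_piecewise (r : ι) (U : Finset ι) (ω ω' : Sym2 ι → ℤˣ) (v : ι → ZMod p) :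
    rowSum ((star r U).piecewise ω' ω) v r =
      ∑ j ∈ U, entry p ω' r j * v j + ∑ j ∈ Uᶜ, entry p ω r j * v j := by
  rw [rowSum, ← sum_add_sum_compl U]
  congr 1 <;> refine sum_congr rfl fun j hj => ?_
  · simp [entry, mk_mem_star.2 hj]
  · rw [mem_compl] at hj
    simp [entry, mk_mem_star, hj]

lemma conc_image {σ τ : Type*} [DecidableEq τ] {e : σ → τ} (he : Function.Injective e)
    (v : τ → ZMod p) (S : Finset σ) : conc v (S.image e) = conc (v ∘ e) S := by
  simp only [conc, energy, sum_image he.injOn, Function.comp_apply]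

/-- Concentration of a partial row sum. -/
lemma prob_partial_row_le (hp2 : p ≠ 2) (r : ι) (U : Finset ι) (v : ι → ZMod p) (a : ZMod p) :
    prob (fun ω : Sym2 ι → ℤˣ => ∑ j ∈ U, entry p ω r j * v j = a) ≤ conc v U := by
  classical
  let C : Sym2 ι → ZMod p := Function.extend (fun u => s(r, u)) v 0
  have hC : C ∘ (fun u => s(r, u)) = v := Function.extend_comp (mk_injective r) v 0
  have h := expect_sign_sum_eq_le hp2 C (star r U) a
  rw [star, conc_image (mk_injective r), hC] at h
  refine le_trans (le_of_eq (expect_congr rfl fun ω _ => ?_)) h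
  rw [sum_image (mk_injective r).injOn]
  simp only [entry, show ∀ u, C s(r, u) = v u from fun u => congrFun hC u]
  congr

lemma prob_rowSum_piecewise_le (hp2 : p ≠ 2) (r : ι) (U : Finset ι) (v : ι → ZMod p)
    (ω : Sym2 ι → ℤˣ) (a : ZMod p) :
    prob (fun ω' => rowSum ((star r U).piecewise ω' ω) v r = a) ≤ conc v U := by
  simp only [rowSum_piecewise, ← eq_sub_iff_add_eq]
  exact prob_partial_row_le hp2 _ _ _ _

/-- Exposing the rows in `S` in order of decreasing rank: the row `r` gains the concentration
of the coordinates in `U r`. -/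
lemma prob_rows_le (hp2 : p ≠ 2) (v z : ι → ZMod p) (rank : ι → ℕ) (U : ι → Finset ι)
    (S : Finset ι) (hU : ∀ r ∈ S, ∀ u ∈ U r, u ∉ S ∨ rank u < rank r) :
    prob (fun ω : Sym2 ι → ℤˣ => ∀ i ∈ S, rowSum ω v i = z i) ≤ ∏ r ∈ S, conc v (U r) := by
  induction S using Finset.induction_on_min_value rank with
  | empty => simpa using prob_le_one _
  | insert r S hr hmin ih =>
    have hUr : ∀ u ∈ U r, u ∉ S := fun u hu huS => by
      rcases hU r (mem_insert_self r S) u hu with h | h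
      · exact h (mem_insert_of_mem huS)
      · exact absurd (hmin u huS) (not_le.2 h)
    have hinv : ∀ ω ω' : Sym2 ι → ℤˣ,
        (∀ i ∈ S, rowSum ((star r (U r)).piecewise ω' ω) v i = z i) ↔
          ∀ i ∈ S, rowSum ω v i = z i := by
      intro ω ω'
      refine forall₂_congr fun i hi => ?_
      rw [rowSum_piecewise_of_notMem (ne_of_mem_of_not_mem hi hr) fun h => hUr i h hi]
    rw [prod_insert hr]
    calc prob (fun ω : Sym2 ι → ℤˣ => ∀ i ∈ insert r S, rowSum ω v i = z i)
        = prob (fun ω : Sym2 ι → ℤˣ => (∀ i ∈ S, rowSum ω v i = z i) ∧ rowSum ω v r = z r) :=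
          prob_congr fun ω => by simp [and_comm]
      _ ≤ conc v (U r) * prob (fun ω : Sym2 ι → ℤˣ => ∀ i ∈ S, rowSum ω v i = z i) :=
          prob_and_le_mul hinv fun ω _ => prob_rowSum_piecewise_le hp2 _ _ _ _ _
      _ ≤ _ := by
          refine mul_le_mul_of_nonneg_left (ih fun i hi u hu => ?_) (conc_pos _ _).le
          exact (hU i (mem_insert_of_mem hi) u hu).imp_left fun h h' => h (mem_insert_of_mem h')

end Rows

section Blocks

variable {p : ℕ} [Fact p.Prime] {ι : Type*} [DecidableEq ι]

/-- A maximal block along which the concentration decays geometrically. -/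
lemma exists_block {v : ι → ZMod p} {A : Finset ι} {β : ℝ} {d : ℕ}
    (hd : (15 / 16 : ℝ) ^ (d + 1) < β) (hA : β ≤ conc v A) :
    ∃ T ⊆ A, #T ≤ d ∧ (∀ x ∈ T, v x ≠ 0) ∧ (∀ x ∈ A, x ∉ T → v x ∈ nbhd v T) ∧
      ((∃ x ∈ A, v x ≠ 0) → T.Nonempty) := by
  classical
  let P := A.powerset.filter fun T => conc v T ≤ (15 / 16) ^ #T ∧ ∀ x ∈ T, v x ≠ 0
  have hP : P.Nonempty := ⟨∅, by simp [P, conc_empty]⟩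
  obtain ⟨T, hT, hmax⟩ := P.exists_max_image card hP
  obtain ⟨hTA, hTc, hT0⟩ : T ⊆ A ∧ conc v T ≤ (15 / 16) ^ #T ∧ ∀ x ∈ T, v x ≠ 0 := by
    simpa [P] using hT
  have hn : ∀ x ∈ A, x ∉ T → v x ∈ nbhd v T := by
    intro x hxA hxT
    by_contra hx
    have hmem : insert x T ∈ P := by
      simp only [P, mem_filter, mem_powerset, insert_subset_iff, hxA, hTA, true_and,
        card_insert_of_notMem hxT, forall_mem_insert]
      refine ⟨?_, fun h => hx (h ▸ mem_nbhd_of_eq_zero v T), hT0⟩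
      refine (conc_insert_le hxT hx).trans ?_
      rw [pow_succ']
      linarith
    have := hmax _ hmem
    rw [card_insert_of_notMem hxT] at this
    omega
  refine ⟨T, hTA, ?_, hT0, hn, ?_⟩
  · by_contra! h
    have h1 : (15 / 16 : ℝ) ^ #T ≤ (15 / 16) ^ (d + 1) :=
      pow_le_pow_of_le_one (by norm_num) (by norm_num) h
    have := conc_mono v hTA
    linarith
  · rintro ⟨x, hxA, hx⟩
    rw [nonempty_iff_ne_empty]
    rintro rfl
    exact hx (mem_nbhd_empty (hn x hxA (by simp)))

/-- Labels recording `k` successive maximal blocks; the label `k` is the default. -/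
lemma exists_block_labels {v : ι → ZMod p} {I : Finset ι} {β : ℝ} {d : ℕ}
    (hd : (15 / 16 : ℝ) ^ (d + 1) < β) (hI : β ≤ conc v I) (k : ℕ)
    (hk : k * d < #{x ∈ I | v x ≠ 0}) :
    ∃ c : ι → ℕ, (∀ x, c x ≤ k) ∧ (∀ x ∉ I, c x = k) ∧
      ∀ i < k, #{x ∈ I | c x = i} ≤ d ∧ (∃ x ∈ ({x ∈ I | c x = i} : Finset ι), v x ≠ 0) ∧
        ∀ x ∈ I, i < c x → v x ∈ nbhd v {x ∈ I | c x = i} := by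
  induction k with
  | zero => exact ⟨fun _ => 0, by simp, by simp, by simp⟩
  | succ k ih =>
    obtain ⟨c, hck, hcI, hc⟩ := ih (by nlinarith)
    let A : Finset ι := {x ∈ I | c x = k}
    have hA : β ≤ conc v A := hI.trans (conc_mono v (filter_subset _ _))
    obtain ⟨T, hTA, hTd, hT0, hTn, hTne⟩ := exists_block hd hA
    have hA0 : ∃ x ∈ A, v x ≠ 0 := by
      by_contra! h
      have hsub : {x ∈ I | v x ≠ 0} ⊆ (range k).biUnion fun i => {x ∈ I | c x = i} := by
        intro x hx
        rw [mem_filter] at hx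
        rw [mem_biUnion]
        refine ⟨c x, ?_, by simp [hx.1]⟩
        rw [mem_range]
        refine lt_of_le_of_ne (hck x) fun hcx => hx.2 (h x ?_)
        simp [A, hx.1, hcx]
      have h1 := (card_le_card hsub).trans
        (card_biUnion_le_card_mul _ _ d fun i hi => (hc i (mem_range.1 hi)).1)
      rw [card_range] at h1
      nlinarith
    let c' : ι → ℕ := fun x => if c x = k ∧ x ∉ T then k + 1 else c x
    have hTk : ∀ x ∈ T, x ∈ I ∧ c x = k := fun x hx => by simpa [A] using hTA hx
    have hlow : ∀ i < k, ({x ∈ I | c' x = i} : Finset ι) = {x ∈ I | c x = i} := by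
      intro i hi
      refine filter_congr fun x _ => ?_
      simp only [c']
      split_ifs with h
      · omega
      · rfl
    have htop : ({x ∈ I | c' x = k} : Finset ι) = T := by
      ext x
      simp only [mem_filter, c']
      constructor
      · rintro ⟨-, h⟩
        split_ifs at h with h1
        · omega
        · by_contra hx; exact h1 ⟨h, hx⟩
      · intro hx
        exact ⟨(hTk x hx).1, by rw [if_neg (by tauto)]; exact (hTk x hx).2⟩
    refine ⟨c', fun x => ?_, fun x hx => ?_, fun i hi => ?_⟩
    · simp only [c']
      have := hck x
      split_ifs <;> omega
    · simp only [c']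
      rw [if_pos ⟨hcI x hx, fun h => hx (hTk x h).1⟩]
    · rcases Nat.lt_succ_iff_lt_or_eq.1 hi with hi | rfl
      · rw [hlow i hi]
        obtain ⟨h1, h2, h3⟩ := hc i hi
        refine ⟨h1, h2, fun x hx hix => h3 x hx ?_⟩
        simp only [c'] at hix
        split_ifs at hix <;> omega
      · rw [htop]
        obtain ⟨x, hx⟩ := hTne hA0
        refine ⟨hTd, ⟨x, hx, hT0 x hx⟩, fun x hx hix => ?_⟩
        simp only [c'] at hix
        have := hck x
        split_ifs at hix with h
        · exact hTn x (by simp [A, hx, h.1]) h.2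
        · omega

/-- The labelings with labels at most `q`, at most `s` of which differ from the default `q`. -/
def labelings (ι : Type*) [Fintype ι] [DecidableEq ι] (q s : ℕ) : Finset (ι → ℕ) :=
  {c ∈ Fintype.piFinset fun _ => range (q + 1) | #{x | c x ≠ q} ≤ s}

lemma mem_labelings [Fintype ι] {q s : ℕ} {c : ι → ℕ} :
    c ∈ labelings ι q s ↔ (∀ x, c x ≤ q) ∧ #{x | c x ≠ q} ≤ s := by
  simp [labelings]

lemma card_labelings_le [Fintype ι] (q s : ℕ) :
    #(labelings ι q s) ≤ (Fintype.card ι * (q + 1) + 1) ^ s := by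
  induction s with
  | zero =>
    rw [pow_zero, card_le_one]
    have h : ∀ c ∈ labelings ι q 0, c = fun _ => q := by
      intro c hc
      have := (mem_labelings.1 hc).2
      simp only [nonpos_iff_eq_zero, card_eq_zero, filter_eq_empty_iff, mem_univ, true_imp_iff,
        not_not] at this
      exact funext fun x => @this x
    intro a ha b hb
    rw [h a ha, h b hb]
  | succ s ih =>
    have hsub : labelings ι q (s + 1) ⊆
        (labelings ι q s ×ˢ insertNone ((univ : Finset ι) ×ˢ range (q + 1))).image
          fun x => x.2.elim x.1 fun y => Function.update x.1 y.1 y.2 := by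
      intro c hc
      obtain ⟨hq, hs⟩ := mem_labelings.1 hc
      rw [mem_image]
      by_cases h0 : ∃ x, c x ≠ q
      · obtain ⟨x, hx⟩ := h0
        refine ⟨(Function.update c x q, some (x, c x)), ?_, by simp⟩
        simp only [mem_product, mem_labelings, mem_insertNone]
        refine ⟨⟨fun y => ?_, ?_⟩, ?_⟩
        · by_cases hy : y = x
          · simp [hy]
          · simpa [hy] using hq y
        · have : ({y | Function.update c x q y ≠ q} : Finset ι) =
              ({y | c y ≠ q} : Finset ι).erase x := by
            ext y
            by_cases hy : y = x
            · simp [hy]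
            · simp [hy]
          rw [this, card_erase_of_mem (by simp [hx])]
          omega
        · simp [hq x]
      · push Not at h0
        refine ⟨(c, none), ?_, rfl⟩
        simp [mem_labelings, h0]
    refine (card_le_card hsub).trans (card_image_le.trans ?_)
    rw [card_product, card_insertNone, card_product, card_univ, card_range, pow_succ]
    exact Nat.mul_le_mul_right _ ih

end Blocks

section Dense

variable {p : ℕ} [Fact p.Prime] {ι : Type*} [Fintype ι] [DecidableEq ι]

omit [Fintype ι] in
lemma conc_update {v : ι → ZMod p} {S : Finset ι} {x : ι} (hx : x ∉ S) (a : ZMod p) :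
    conc (Function.update v x a) S = conc v S :=
  conc_congr fun _ hi => Function.update_of_ne (ne_of_mem_of_not_mem hi hx) _ _

omit [Fintype ι] in
lemma nbhd_update {v : ι → ZMod p} {S : Finset ι} {x : ι} (hx : x ∉ S) (a : ZMod p) :
    nbhd (Function.update v x a) S = nbhd v S :=
  nbhd_congr fun _ hi => Function.update_of_ne (ne_of_mem_of_not_mem hi hx) _ _

lemma sum_ite_mem_eq (s : Finset (ZMod p)) (r : ℝ) :
    ∑ a, (if a ∈ s then r else 0) = #s * r := by simp

/-- The block of label `i`. -/
def block (I : Finset ι) (c : ι → ℕ) (i : ℕ) : Finset ι := {x ∈ I | c x = i}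

/-- The largest concentration among the blocks of labels less than `k + 1`. -/
noncomputable def maxConc (I : Finset ι) (c : ι → ℕ) (k : ℕ) (v : ι → ZMod p) : ℝ :=
  (range (k + 1)).sup' nonempty_range_add_one fun i => conc v (block I c i)

open Classical in
/-- The weights controlling the number of vectors of dense support. -/
noncomputable def denseWeight (W J : Finset ι) (k : ℕ) (γ : ℝ) (c : ι → ℕ) (y : ι)
    (v : ι → ZMod p) : ℝ :=
  if y ∉ W then if v y = 0 then 1 else 0
  else if y ∈ J ∨ c y = 0 then 1
  else if c y < k + 1 then
    if v y ∈ nbhd v (block (W \ J) c (c y - 1)) then conc v (block (W \ J) c (c y - 1)) else 0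
  else if ∀ i < k + 1, v y ∈ nbhd v (block (W \ J) c i) then γ * maxConc (W \ J) c k v else 0

omit [Fintype ι] in
lemma maxConc_update {v : ι → ZMod p} {I : Finset ι} {c : ι → ℕ} {k : ℕ} {x : ι}
    (hx : ∀ i < k + 1, x ∉ block I c i) (a : ZMod p) :
    maxConc I c k (Function.update v x a) = maxConc I c k v :=
  sup'_congr _ rfl fun i hi => conc_update (hx i (mem_range.1 hi)) a

omit [Fintype ι] [DecidableEq ι] in
lemma maxConc_pos (I : Finset ι) (c : ι → ℕ) (k : ℕ) (v : ι → ZMod p) : 0 < maxConc I c k v :=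
  (conc_pos v (block I c 0)).trans_le
    (le_sup' (fun i => conc v (block I c i)) (mem_range.2 k.succ_pos))

omit [Fintype ι] in
lemma denseWeight_nonneg (W J : Finset ι) (k : ℕ) {γ : ℝ} (hγ : 0 ≤ γ) (c : ι → ℕ) (y : ι)
    (v : ι → ZMod p) : 0 ≤ denseWeight W J k γ c y v := by
  have h1 := conc_pos v (block (W \ J) c (c y - 1))
  have h2 := maxConc_pos (W \ J) c k v
  unfold denseWeight
  split_ifs <;> positivity

/-- The order in which the coordinates are exposed. -/
def denseRank (J : Finset ι) (c : ι → ℕ) (y : ι) : ℕ := if y ∈ J then 0 else c y + 1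

omit [Fintype ι] in
lemma denseWeight_update {W J : Finset ι} {k : ℕ} {γ : ℝ} {c : ι → ℕ} {x y : ι}
    (hxy : x ≠ y) (hr : denseRank J c y ≤ denseRank J c x) (v : ι → ZMod p) (a : ZMod p) :
    denseWeight W J k γ c y (Function.update v x a) = denseWeight W J k γ c y v := by
  have hy : Function.update v x a y = v y := Function.update_of_ne hxy.symm _ _
  have hx : ∀ i, y ∉ J → i < c y → x ∉ block (W \ J) c i := by
    intro i hyJ hi hx
    simp only [block, mem_filter, mem_sdiff] at hx
    rw [denseRank, denseRank, if_neg hyJ, if_neg hx.1.2] at hr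
    omega
  unfold denseWeight
  rw [hy]
  by_cases h1 : y ∉ W
  · rw [if_pos h1, if_pos h1]
  rw [if_neg h1, if_neg h1]
  by_cases h2 : y ∈ J ∨ c y = 0
  · rw [if_pos h2, if_pos h2]
  rw [if_neg h2, if_neg h2]
  push Not at h2
  by_cases h3 : c y < k + 1
  · rw [if_pos h3, if_pos h3, conc_update (hx _ h2.1 (by omega)),
      nbhd_update (hx _ h2.1 (by omega))]
  rw [if_neg h3, if_neg h3, maxConc_update fun i hi => hx i h2.1 (by omega)]
  refine if_congr (forall₂_congr fun i hi => ?_) rfl rfl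
  rw [nbhd_update (hx i h2.1 (by omega))]

omit [Fintype ι] in
lemma sum_denseWeight_le {W J : Finset ι} {k : ℕ} {γ : ℝ} (hγ : 0 ≤ γ) {c : ι → ℕ} (y : ι)
    (v : ι → ZMod p) :
    ∑ a, denseWeight W J k γ c y (Function.update v y a) ≤
      if y ∉ W then 1 else if y ∈ J ∨ c y = 0 then (p : ℝ) else if c y < k + 1 then 4
      else 4 * γ := by
  have hy : ∀ i, i < c y → y ∉ block (W \ J) c i := by
    intro i hi hx
    simp only [block, mem_filter] at hx
    omega
  unfold denseWeight
  simp only [Function.update_self]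
  split_ifs with h1 h2 h3
  · simp
  · have h := hy (c y - 1) (by omega)
    simp only [conc_update h, nbhd_update h, sum_ite_mem_eq]
    exact card_nbhd_mul_conc_le _ _
  · have h : ∀ i < k + 1, y ∉ block (W \ J) c i := fun i hi => hy i (by omega)
    obtain ⟨i, hi, hmax⟩ := exists_mem_eq_sup' nonempty_range_add_one
      fun i => conc v (block (W \ J) c i)
    rw [mem_range] at hi
    calc _ ≤ ∑ a, if a ∈ nbhd v (block (W \ J) c i) then
          γ * conc v (block (W \ J) c i) else 0 := by
          refine sum_le_sum fun a _ => ?_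
          rw [maxConc_update h, maxConc, hmax]
          have h0 := (conc_pos v (block (W \ J) c i)).le
          split_ifs with h4 h5 h5
          · exact le_rfl
          · exact absurd (nbhd_update (h i hi) a ▸ h4 i hi) h5
          · positivity
          · exact le_rfl
      _ ≤ 4 * γ := by
          rw [sum_ite_mem_eq]
          have := card_nbhd_mul_conc_le v (block (W \ J) c i)
          nlinarith
  · simp

omit [Fintype ι] in
lemma le_denseWeight {W J : Finset ι} {k : ℕ} {γ : ℝ} {c : ι → ℕ} {v : ι → ZMod p} {y : ι}
    (hy : y ∈ W \ J)
    (hmem : ∀ i < k + 1, i < c y → v y ∈ nbhd v (block (W \ J) c i))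
    (hγ : conc v ((range (k + 1)).biUnion (block (W \ J) c)) ≤ γ * maxConc (W \ J) c k v) :
    conc v (if c y = 0 then ∅ else if c y < k + 1 then block (W \ J) c (c y - 1)
      else (range (k + 1)).biUnion (block (W \ J) c)) ≤ denseWeight W J k γ c y v := by
  rw [mem_sdiff] at hy
  unfold denseWeight
  rw [if_neg (not_not.2 hy.1)]
  by_cases h0 : c y = 0
  · simp [h0, conc_empty]
  rw [if_neg h0, if_neg (show ¬(y ∈ J ∨ c y = 0) by tauto)]
  by_cases h1 : c y < k + 1
  · rw [if_pos h1, if_pos h1, if_pos (hmem _ (by omega) (by omega))]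
  · rw [if_neg h1, if_neg h1, if_pos fun i hi => hmem i hi (by omega)]
    exact hγ

lemma prod_denseBound_le {W J : Finset ι} (hJ : J ⊆ W) {k d j : ℕ} {γ : ℝ} (hγ : 0 ≤ γ)
    (hγ1 : γ ≤ 1) {c : ι → ℕ} (hj : #J ≤ j) (h0 : #(block (W \ J) c 0) ≤ d)
    (hs : #{x | c x ≠ k + 1} ≤ (k + 1) * d) :
    ∏ y, (if y ∉ W then 1 else if y ∈ J ∨ c y = 0 then (p : ℝ) else if c y < k + 1 then 4
      else 4 * γ) ≤ p ^ (j + d) * 4 ^ #W * γ ^ (#W - j - (k + 1) * d) := by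
  have hp : (1 : ℝ) ≤ p := by exact_mod_cast (Fact.out : p.Prime).one_le
  have h4 : ∏ y, (if y ∈ W then (4 : ℝ) else 1) = 4 ^ #W := by
    rw [prod_ite_mem, univ_inter, prod_const]
  let P : Finset ι := J ∪ block (W \ J) c 0
  have hP : ∏ y, (if y ∈ P then (p : ℝ) else 1) ≤ p ^ (j + d) := by
    rw [prod_ite_mem, univ_inter, prod_const]
    exact pow_le_pow_right₀ hp ((card_union_le _ _).trans (by omega))
  let R : Finset ι := {x ∈ W \ J | k + 1 ≤ c x}
  have hR : ∏ y, (if y ∈ R then γ else 1) ≤ γ ^ (#W - j - (k + 1) * d) := by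
    rw [prod_ite_mem, univ_inter, prod_const]
    refine pow_le_pow_of_le_one hγ hγ1 ?_
    have h1 : W \ J ⊆ R ∪ ({x | c x ≠ k + 1} : Finset ι) := by
      intro x hx
      simp only [R, mem_union, mem_filter, mem_univ, true_and]
      by_cases h : c x = k + 1
      · exact Or.inl ⟨hx, h.ge⟩
      · exact Or.inr h
    have h2 := (card_le_card h1).trans (card_union_le _ _)
    rw [card_sdiff_of_subset hJ] at h2
    omega
  rw [← h4]
  refine le_trans ?_ (mul_le_mul (mul_le_mul_of_nonneg_right hP (by positivity)) hR
    (by positivity) (by positivity))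
  rw [← prod_mul_distrib, ← prod_mul_distrib]
  refine prod_le_prod (fun y _ => by split_ifs <;> positivity) fun y _ => ?_
  by_cases hW : y ∈ W
  · by_cases hJy : y ∈ J
    · simp [P, R, hW, hJy]
      linarith
    · by_cases hc0 : c y = 0
      · simp [P, R, block, hW, hJy, hc0]
        linarith
      · by_cases hck : c y < k + 1
        · simp [P, R, block, hW, hJy, hc0, hck, show ¬ k < c y by omega]
        · simp [P, R, block, hW, hJy, hc0, hck, show k < c y by omega]
  · have : y ∉ J := fun h => hW (hJ h)
    simp [P, R, block, hW, this]

/-- The contribution of the vectors of dense support. -/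
lemma prob_dense_le (hp2 : p ≠ 2) {W J : Finset ι} (hJ : J ⊆ W) {d l : ℕ} {β : ℝ}
    (hl : (11 : ℝ) ≤ 2 ^ l) (hd : (15 / 16 : ℝ) ^ (d + 1) < β) (hpβ : 1 / (p : ℝ) ≤ β / 2 ^ l)
    (z : ι → ZMod p) :
    prob (fun ω : Sym2 ι → ℤˣ => ∃ v : ι → ZMod p,
      ((∀ x ∉ W, v x = 0) ∧ 16 ^ l * d < #{x ∈ W \ J | v x ≠ 0} ∧ β ≤ conc v (W \ J)) ∧
        ∀ i ∈ W, rowSum ω v i = z i) ≤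
      ((Fintype.card ι * (16 ^ l + 1) + 1) ^ (16 ^ l * d) : ℕ) *
        (p ^ (#J + d) * 4 ^ #W * (11 / 2 ^ l : ℝ) ^ (#W - #J - 16 ^ l * d)) := by
  classical
  obtain ⟨k, hk⟩ := Nat.exists_eq_add_one_of_ne_zero (pow_ne_zero l (show (16 : ℕ) ≠ 0 by norm_num))
  set γ : ℝ := 11 / 2 ^ l with hγdef
  have hγ : 0 ≤ γ := by positivity
  have hγ1 : γ ≤ 1 := by rw [hγdef, div_le_one (by positivity)]; exact hl
  rw [hk]
  let C : Finset (ι → ℕ) :=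
    {c ∈ labelings ι (k + 1) ((k + 1) * d) | #(block (W \ J) c 0) ≤ d}
  have hC : (#C : ℝ) ≤ ((Fintype.card ι * (k + 1 + 1) + 1) ^ ((k + 1) * d) : ℕ) := by
    exact_mod_cast (card_filter_le _ _).trans (card_labelings_le _ _)
  refine (prob_exists_and_le_card_mul (B := p ^ (#J + d) * 4 ^ #W * γ ^ (#W - #J - (k + 1) * d))
    C (fun c v => ∏ y, denseWeight W J k γ c y v)
    (fun c v => prod_nonneg fun y _ => denseWeight_nonneg W J k hγ c y v) ?_ ?_).trans
    (mul_le_mul_of_nonneg_right hC (by positivity))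
  · rintro v ⟨hvW, hdense, hβ⟩
    obtain ⟨c, hck, hcI, hc⟩ := exists_block_labels hd hβ (k + 1) hdense
    refine ⟨c, ?_, ?_⟩
    · simp only [C, mem_filter, mem_labelings]
      refine ⟨⟨hck, ?_⟩, (hc 0 k.succ_pos).1⟩
      have hsub : ({x | c x ≠ k + 1} : Finset ι) ⊆
          (range (k + 1)).biUnion fun i => {x ∈ W \ J | c x = i} := by
        intro x hx
        rw [mem_filter] at hx
        rw [mem_biUnion]
        refine ⟨c x, mem_range.2 (lt_of_le_of_ne (hck x) hx.2), ?_⟩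
        rw [mem_filter]
        exact ⟨by by_contra h; exact hx.2 (hcI x h), rfl⟩
      have := (card_le_card hsub).trans
        (card_biUnion_le_card_mul _ _ d fun i hi => (hc i (mem_range.1 hi)).1)
      rwa [card_range] at this
    · have hM : ∀ i ∈ range (k + 1), conc v (block (W \ J) c i) ≤ maxConc (W \ J) c k v :=
        fun i hi => le_sup' (fun i => conc v (block (W \ J) c i)) hi
      have hβM : β ≤ maxConc (W \ J) c k v :=
        (hβ.trans (conc_mono v (filter_subset _ _))).trans (hM 0 (mem_range.2 k.succ_pos))
      have hunion : conc v ((range (k + 1)).biUnion (block (W \ J) c)) ≤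
          γ * maxConc (W \ J) c k v := by
        refine (conc_biUnion_le (l := l) (by rw [card_range, hk]) ?_
          (fun i hi => (hc i (mem_range.1 hi)).2.1) hM).trans ?_
        · intro i _ i' _ hii
          refine disjoint_left.2 fun x hx hx' => hii ?_
          simp only [mem_filter] at hx hx'
          exact hx.2.symm.trans hx'.2
        · have h1 : β / 2 ^ l ≤ maxConc (W \ J) c k v / 2 ^ l := by gcongr
          have h2 : γ * maxConc (W \ J) c k v =
            maxConc (W \ J) c k v / 2 ^ l + 10 / 2 ^ l * maxConc (W \ J) c k v := by
            rw [hγdef]; ring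
          linarith
      let U : ι → Finset ι := fun y => if c y = 0 then ∅ else if c y < k + 1 then
        block (W \ J) c (c y - 1) else (range (k + 1)).biUnion (block (W \ J) c)
      calc prob (fun ω : Sym2 ι → ℤˣ => ∀ i ∈ W, rowSum ω v i = z i)
          ≤ prob (fun ω : Sym2 ι → ℤˣ => ∀ i ∈ W \ J, rowSum ω v i = z i) :=
            prob_mono fun ω h i hi => h i (mem_sdiff.1 hi).1
        _ ≤ ∏ y ∈ W \ J, conc v (U y) := by
            refine prob_rows_le hp2 v z c U (W \ J) fun r hr u hu => Or.inr ?_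
            simp only [U] at hu
            split_ifs at hu with h1 h2
            · simp at hu
            · have := (mem_filter.1 hu).2
              omega
            · obtain ⟨i, hi, hu⟩ := mem_biUnion.1 hu
              have := (mem_filter.1 hu).2
              rw [mem_range] at hi
              omega
        _ = ∏ y, if y ∈ W \ J then conc v (U y) else 1 := by
            rw [prod_ite_mem, univ_inter]
        _ ≤ ∏ y, denseWeight W J k γ c y v := by
            refine prod_le_prod (fun y _ => ?_) fun y _ => ?_
            · have := (conc_pos v (U y)).le
              split_ifs <;> positivity
            · split_ifs with hy
              · exact le_denseWeight hy (fun i hi hic => (hc i hi).2.2 y hy hic) hunion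
              · unfold denseWeight
                by_cases hyW : y ∈ W
                · have : y ∈ J := by simpa [hyW] using hy
                  simp [hyW, this]
                · simp [hyW, hvW y hyW]
  · intro c hc
    simp only [C, mem_filter, mem_labelings] at hc
    refine (sum_prod_le_prod (denseRank J c) _ (fun y v => denseWeight_nonneg W J k hγ c y v)
      (fun y x v a hxy hr => denseWeight_update hxy hr v a)
      fun y v => sum_denseWeight_le hγ y v).trans ?_
    exact prod_denseBound_le hJ hγ hγ1 le_rfl hc.2 hc.1.2

end Dense

section Sparse

variable {p : ℕ} [Fact p.Prime] {ι : Type*} [Fintype ι] [DecidableEq ι]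

/-- The weights controlling the number of vectors of sparse support: the label `0` marks free
coordinates, the label `2` vanishing ones. -/
noncomputable def sparseWeight (I : Finset ι) (c : ι → ℕ) (y : ι) (v : ι → ZMod p) : ℝ :=
  if c y = 0 then 1
  else if c y = 1 then if v y ∈ nbhd v (block I c 0) then conc v (block I c 0) else 0
  else if v y = 0 then 1 else 0

omit [Fintype ι] [DecidableEq ι] in
lemma sparseWeight_nonneg (I : Finset ι) (c : ι → ℕ) (y : ι) (v : ι → ZMod p) :
    0 ≤ sparseWeight I c y v := by
  have := conc_pos v (block I c 0)
  unfold sparseWeight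
  split_ifs <;> positivity

omit [Fintype ι] in
lemma sparseWeight_update {I : Finset ι} {c : ι → ℕ} {x y : ι} (hxy : x ≠ y) (hr : c y ≤ c x)
    (v : ι → ZMod p) (a : ZMod p) :
    sparseWeight I c y (Function.update v x a) = sparseWeight I c y v := by
  have hy : Function.update v x a y = v y := Function.update_of_ne hxy.symm _ _
  unfold sparseWeight
  by_cases h0 : c y = 0
  · rw [if_pos h0, if_pos h0]
  have hx : x ∉ block I c 0 := fun h => h0 (by have := (mem_filter.1 h).2; omega)
  rw [hy, conc_update hx, nbhd_update hx]

omit [Fintype ι] in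
lemma sum_sparseWeight_le {I : Finset ι} {c : ι → ℕ} (y : ι) (v : ι → ZMod p) :
    ∑ a, sparseWeight I c y (Function.update v y a) ≤
      if c y = 0 then (p : ℝ) else if c y = 1 then 4 else 1 := by
  unfold sparseWeight
  simp only [Function.update_self]
  split_ifs with h0 h1
  · simp [ZMod.card]
  · have hy : y ∉ block I c 0 := fun h => h0 (mem_filter.1 h).2
    simp only [conc_update hy, nbhd_update hy, sum_ite_mem_eq]
    exact card_nbhd_mul_conc_le _ _
  · simp

/-- The contribution of the vectors of sparse support. -/
lemma prob_sparse_le (hp2 : p ≠ 2) {W J : Finset ι} {d s f : ℕ} {β γ : ℝ}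
    (hγ : 0 ≤ γ) (hγ1 : γ ≤ 1) (hf : s ≤ f ∨ #J + d ≤ f) (hs : 2 * s ≤ #W)
    (hd : (15 / 16 : ℝ) ^ (d + 1) < β) (z : ι → ZMod p) :
    prob (fun ω : Sym2 ι → ℤˣ => ∃ v : ι → ZMod p,
      ((∀ x ∉ W, v x = 0) ∧ #{x | v x ≠ 0} ≤ s ∧ conc v {x | v x ≠ 0} ≤ γ ∧
        β ≤ conc v (W \ J)) ∧ ∀ i ∈ W, rowSum ω v i = z i) ≤
      ((Fintype.card ι * 3 + 1) ^ s : ℕ) * (γ ^ (#W - 2 * s) * (p ^ f * 4 ^ s)) := by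
  classical
  let C : Finset (ι → ℕ) := {c ∈ labelings ι 2 s | #{x | c x = 0} ≤ f}
  have hC : (#C : ℝ) ≤ ((Fintype.card ι * 3 + 1) ^ s : ℕ) := by
    exact_mod_cast (card_filter_le _ _).trans (card_labelings_le _ _)
  refine (prob_exists_and_le_card_mul (B := γ ^ (#W - 2 * s) * (p ^ f * 4 ^ s))
    C (fun c v => γ ^ (#W - 2 * s) * ∏ y, sparseWeight (W \ J) c y v)
    (fun c v => mul_nonneg (by positivity)
      (prod_nonneg fun y _ => sparseWeight_nonneg (W \ J) c y v)) ?_ ?_).trans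
    (mul_le_mul_of_nonneg_right hC (by positivity))
  · rintro v ⟨hvW, hsparse, hvγ, hβ⟩
    set S : Finset ι := {x | v x ≠ 0} with hS
    have hSW : S ⊆ W := fun x hx => by
      by_contra h
      exact (mem_filter.1 hx).2 (hvW x h)
    obtain ⟨T, hTA, hTd, hT0, hTn, -⟩ := exists_block hd hβ
    have hTS : T ⊆ S := fun x hx => by simpa [S] using hT0 x hx
    let c : ι → ℕ := fun x => if x ∉ S then 2 else if x ∈ J ∨ x ∈ T then 0 else 1
    have hc2 : ∀ x, c x ≠ 2 ↔ x ∈ S := fun x => by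
      simp only [c]; split_ifs <;> simp_all
    have hc0 : ∀ x, c x = 0 ↔ x ∈ S ∧ (x ∈ J ∨ x ∈ T) := fun x => by
      simp only [c]; split_ifs <;> simp_all
    have hc1 : ∀ x, c x = 1 ↔ x ∈ S ∧ ¬ (x ∈ J ∨ x ∈ T) := fun x => by
      simp only [c]; split_ifs <;> simp_all
    have hblock : block (W \ J) c 0 = T := by
      ext x
      simp only [block, mem_filter, hc0, mem_sdiff]
      constructor
      · tauto
      · intro hx
        have := mem_sdiff.1 (hTA hx)
        exact ⟨this, hTS hx, Or.inr hx⟩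
    refine ⟨c, ?_, ?_⟩
    · simp only [C, mem_filter, mem_labelings, hc2, hc0]
      refine ⟨⟨fun x => ?_, ?_⟩, ?_⟩
      · simp only [c]; split_ifs <;> omega
      · simpa using hsparse
      · rcases hf with hf | hf
        · refine le_trans (card_le_card ?_) (hsparse.trans hf)
          intro x hx; exact (mem_filter.1 hx).2.1
        · refine le_trans (card_le_card (t := J ∪ T) ?_) ((card_union_le _ _).trans (by omega))
          intro x hx; exact mem_union.2 (mem_filter.1 hx).2.2
    · let R : Finset ι := {x | c x = 1}
      have hRS : R ⊆ S := fun x hx => ((hc1 x).1 (mem_filter.1 hx).2).1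
      have hprod : ∏ y, sparseWeight (W \ J) c y v = conc v T ^ #R := by
        rw [← prod_const, ← univ_inter R, ← prod_ite_mem]
        refine prod_congr rfl fun y _ => ?_
        unfold sparseWeight
        rw [hblock]
        simp only [R, mem_filter, mem_univ, true_and]
        by_cases hy : y ∈ S
        · by_cases hy' : y ∈ J ∨ y ∈ T
          · have := (hc0 y).2 ⟨hy, hy'⟩
            simp [this]
          · have h1 := (hc1 y).2 ⟨hy, hy'⟩
            have h2 : v y ∈ nbhd v T := hTn y (mem_sdiff.2 ⟨hSW hy, by tauto⟩) (by tauto)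
            simp [h1, h2]
        · have h1 : c y = 2 := by simp [c, hy]
          have h2 : v y = 0 := by simpa [S] using hy
          simp [h1, h2]
      have hR := card_le_card hRS
      have hcS := (conc_pos v S).le
      calc prob (fun ω : Sym2 ι → ℤˣ => ∀ i ∈ W, rowSum ω v i = z i)
          ≤ prob (fun ω : Sym2 ι → ℤˣ => ∀ i ∈ W \ S, rowSum ω v i = z i) :=
            prob_mono fun ω h i hi => h i (mem_sdiff.1 hi).1
        _ ≤ ∏ y ∈ W \ S, conc v S := by
            refine prob_rows_le hp2 v z (fun _ => 0) (fun _ => S) (W \ S) fun r _ u hu => Or.inl ?_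
            simp [hu]
        _ = conc v S ^ (#W - #S - #R) * conc v S ^ #R := by
            rw [prod_const, card_sdiff_of_subset hSW, ← pow_add]
            congr 1
            omega
        _ ≤ γ ^ (#W - 2 * s) * conc v T ^ #R := by
            refine mul_le_mul ?_ (pow_le_pow_left₀ hcS (conc_mono v hTS) _) (by positivity)
              (by positivity)
            exact (pow_le_pow_left₀ hcS hvγ _).trans
              (pow_le_pow_of_le_one hγ hγ1 (by omega))
        _ = _ := by rw [hprod]
  · intro c hc
    simp only [C, mem_filter, mem_labelings] at hc
    rw [← mul_sum]
    refine mul_le_mul_of_nonneg_left ?_ (by positivity)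
    refine (sum_prod_le_prod c _ (fun y v => sparseWeight_nonneg (W \ J) c y v)
      (fun y x v a hxy hr => sparseWeight_update hxy hr v a)
      fun y v => sum_sparseWeight_le y v).trans ?_
    have hp : (1 : ℝ) ≤ p := by exact_mod_cast (Fact.out : p.Prime).one_le
    calc ∏ y, (if c y = 0 then (p : ℝ) else if c y = 1 then 4 else 1)
        ≤ ∏ y, (if y ∈ ({x | c x = 0} : Finset ι) then (p : ℝ) else 1) *
            (if y ∈ ({x | c x ≠ 2} : Finset ι) then 4 else 1) := by
          refine prod_le_prod (fun y _ => by split_ifs <;> positivity) fun y _ => ?_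
          have h2 := hc.1.1 y
          interval_cases h : c y
          · simp [h]
            linarith
          · simp [h]
          · simp [h]
      _ = (p : ℝ) ^ #{x | c x = 0} * 4 ^ #{x | c x ≠ 2} := by
          rw [prod_mul_distrib, prod_ite_mem, univ_inter, prod_const, prod_ite_mem, univ_inter,
            prod_const]
      _ ≤ p ^ f * 4 ^ s :=
          mul_le_mul (pow_le_pow_right₀ hp hc.2) (pow_le_pow_right₀ (by norm_num) hc.1.2)
            (by positivity) (by positivity)

/-- The bound for the probability that a structured nonzero vector has a prescribed image. -/
noncomputable def structuredBound (N w j d l p : ℕ) : ℝ :=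
  ((N * (16 ^ l + 1) + 1) ^ (16 ^ l * d) : ℕ) *
      (p ^ (j + d) * 4 ^ w * (11 / 2 ^ l : ℝ) ^ (w - j - 16 ^ l * d)) +
    ((N * 3 + 1) ^ (16 ^ l * d + j) : ℕ) *
      ((11 / 2 ^ l : ℝ) ^ (w - 2 * (16 ^ l * d + j)) * (p ^ (j + d) * 4 ^ (16 ^ l * d + j))) +
    ((N * 3 + 1) ^ 16 ^ l : ℕ) *
      ((15 / 16 : ℝ) ^ (w - 2 * 16 ^ l) * (p ^ 16 ^ l * 4 ^ 16 ^ l))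

lemma conc_support_le {v : ι → ZMod p} {l : ℕ} {β : ℝ} (hβ : β ≤ 1)
    (hpβ : 1 / (p : ℝ) ≤ β / 2 ^ l) (hv : 16 ^ l ≤ #{x | v x ≠ 0}) :
    conc v {x | v x ≠ 0} ≤ 11 / 2 ^ l := by
  obtain ⟨K, hKS, hK⟩ := exists_subset_card_eq hv
  have h := conc_biUnion_le (v := v) hK (T := fun x => {x}) (fun x _ y _ hxy => by simpa using hxy)
    (fun x hx => ⟨x, by simp, by simpa using hKS hx⟩) fun x _ => conc_le_one v {x}
  rw [biUnion_singleton_eq_self] at h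
  have h1 : β / 2 ^ l ≤ 1 / 2 ^ l := by gcongr
  have h2 : (11 : ℝ) / 2 ^ l = 1 / 2 ^ l + 10 / 2 ^ l * 1 := by ring
  have h3 := conc_mono v hKS
  linarith

/-- With high probability every nonzero vector supported in `W` with a prescribed image has
small concentration on `W \ J`. -/
lemma prob_structured_le (hp2 : p ≠ 2) {W J : Finset ι} (hJ : J ⊆ W) {d l : ℕ} {β : ℝ}
    (hl : (11 : ℝ) ≤ 2 ^ l) (hd : (15 / 16 : ℝ) ^ (d + 1) < β) (hpβ : 1 / (p : ℝ) ≤ β / 2 ^ l)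
    (hW : 2 * (16 ^ l * d + #J) ≤ #W) (hWl : 2 * 16 ^ l ≤ #W) (z : ι → ZMod p) :
    prob (fun ω : Sym2 ι → ℤˣ => ∃ v : ι → ZMod p, v ≠ 0 ∧ (∀ x ∉ W, v x = 0) ∧
      (∀ i ∈ W, rowSum ω v i = z i) ∧ β ≤ conc v (W \ J)) ≤
      structuredBound (Fintype.card ι) #W #J d l p := by
  classical
  have hγ1 : (11 / 2 ^ l : ℝ) ≤ 1 := by rw [div_le_one (by positivity)]; exact hl
  refine le_trans (prob_mono fun ω => ?_) ((prob_or_le _ _).trans (add_le_add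
    ((prob_or_le _ _).trans (add_le_add (prob_dense_le hp2 hJ hl hd hpβ z)
      (prob_sparse_le hp2 (by positivity) hγ1 (Or.inr le_rfl) hW hd z)))
    (prob_sparse_le (J := J) hp2 (by norm_num) (by norm_num) (Or.inl le_rfl) hWl hd z)))
  rintro ⟨v, hv0, hvW, hrow, hβ⟩
  have hβ1 := hβ.trans (conc_le_one _ _)
  by_cases hk : 16 ^ l ≤ #{x | v x ≠ 0}
  · refine Or.inl ?_
    by_cases hdense : #{x | v x ≠ 0} ≤ 16 ^ l * d + #J
    · exact Or.inr ⟨v, ⟨hvW, hdense, conc_support_le hβ1 hpβ hk, hβ⟩, hrow⟩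
    · refine Or.inl ⟨v, ⟨hvW, ?_, hβ⟩, hrow⟩
      have hsub : ({x | v x ≠ 0} : Finset ι) ⊆ ({x ∈ W \ J | v x ≠ 0} : Finset ι) ∪ J := by
        intro x hx
        have hx0 := (mem_filter.1 hx).2
        have hxW : x ∈ W := by by_contra h; exact hx0 (hvW x h)
        simp only [mem_union, mem_filter, mem_sdiff]
        tauto
      have := (card_le_card hsub).trans (card_union_le _ _)
      omega
  · obtain ⟨x, hx⟩ := Function.ne_iff.1 hv0
    refine Or.inr ⟨v, ⟨hvW, by omega, ?_, hβ⟩, hrow⟩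
    exact (conc_mono v (singleton_subset_iff.2 (by simpa using hx))).trans (conc_singleton_le hx)

end Sparse

section Kernel

variable {p : ℕ} [Fact p.Prime] {ι : Type*} [Fintype ι] [DecidableEq ι]

omit [Fact p.Prime] [Fintype ι] [DecidableEq ι] in
lemma entry_comm (ω : Sym2 ι → ℤˣ) (i j : ι) : entry p ω i j = entry p ω j i := by
  rw [entry, Sym2.eq_swap, entry]

omit [DecidableEq ι] in
lemma rowSum_add (ω : Sym2 ι → ℤˣ) (v w : ι → ZMod p) (i : ι) :
    rowSum ω (v + w) i = rowSum ω v i + rowSum ω w i := by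
  simp [rowSum, mul_add, sum_add_distrib]

omit [DecidableEq ι] in
lemma rowSum_sub (ω : Sym2 ι → ℤˣ) (v w : ι → ZMod p) (i : ι) :
    rowSum ω (v - w) i = rowSum ω v i - rowSum ω w i := by
  simp [rowSum, mul_sub, sum_sub_distrib]

omit [DecidableEq ι] in
lemma rowSum_smul (ω : Sym2 ι → ℤˣ) (a : ZMod p) (v : ι → ZMod p) (i : ι) :
    rowSum ω (a • v) i = a * rowSum ω v i := by
  simp [rowSum, mul_sum, mul_left_comm]

lemma rowSum_single (ω : Sym2 ι → ℤˣ) (x i : ι) :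
    rowSum ω (Pi.single x 1) i = entry p ω i x := by
  simp [rowSum, Pi.single_apply]

omit [DecidableEq ι] in
lemma sum_rowSum_mul_comm (ω : Sym2 ι → ℤˣ) (v w : ι → ZMod p) :
    ∑ i, rowSum ω v i * w i = ∑ i, rowSum ω w i * v i := by
  simp only [rowSum, sum_mul]
  rw [sum_comm]
  refine sum_congr rfl fun i _ => sum_congr rfl fun j _ => ?_
  rw [entry_comm]; ring

/-- The kernel of the principal submatrix indexed by `W`. -/
def ker (p : ℕ) [Fact p.Prime] (ω : Sym2 ι → ℤˣ) (W : Finset ι) :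
    Submodule (ZMod p) (ι → ZMod p) where
  carrier := {v | (∀ x ∉ W, v x = 0) ∧ ∀ i ∈ W, rowSum ω v i = 0}
  zero_mem' := by simp [rowSum]
  add_mem' := by
    rintro v w ⟨hv, hv'⟩ ⟨hw, hw'⟩
    exact ⟨fun x hx => by simp [hv x hx, hw x hx],
      fun i hi => by rw [rowSum_add, hv' i hi, hw' i hi, add_zero]⟩
  smul_mem' := by
    rintro a v ⟨hv, hv'⟩
    exact ⟨fun x hx => by simp [hv x hx], fun i hi => by rw [rowSum_smul, hv' i hi, mul_zero]⟩

omit [DecidableEq ι] in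
lemma finrank_ker_le (ω : Sym2 ι → ℤˣ) (W : Finset ι) :
    Module.finrank (ZMod p) (ker p ω W) ≤ #W := by
  have h := LinearMap.finrank_le_finrank_of_injective
    (f := (LinearMap.funLeft (ZMod p) (ZMod p) ((↑) : W → ι)).domRestrict (ker p ω W)) ?_
  · simpa using h
  · rw [← LinearMap.ker_eq_bot, LinearMap.ker_eq_bot']
    rintro ⟨v, hv⟩ h
    ext x
    by_cases hx : x ∈ W
    · simpa using congrFun h ⟨x, hx⟩
    · exact hv.1 x hx

/-- A row that does not annihilate the kernel makes it strictly smaller. -/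
lemma ker_insert_lt {ω : Sym2 ι → ℤˣ} {W : Finset ι} {x : ι} {v : ι → ZMod p}
    (hv : v ∈ ker p ω W) (hx : rowSum ω v x ≠ 0) : ker p ω (insert x W) < ker p ω W := by
  refine SetLike.lt_iff_le_and_exists.2 ⟨fun u hu => ?_, v, hv,
    fun h => hx (h.2 x (mem_insert_self _ _))⟩
  have h := sum_rowSum_mul_comm ω u v
  rw [sum_eq_zero fun i _ => ?_, sum_eq_single x (fun i _ hi => ?_) (by simp)] at h
  · refine ⟨fun y hy => ?_, fun i hi => hu.2 i (mem_insert_of_mem hi)⟩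
    by_cases hyx : y = x
    · subst hyx
      exact (mul_eq_zero.1 h.symm).resolve_left hx
    · exact hu.1 y (by simp [hyx, hy])
  · by_cases hi' : i ∈ W
    · rw [hv.2 i hi', zero_mul]
    · rw [hu.1 i (by simp [hi, hi']), mul_zero]
  · by_cases hi' : i ∈ W
    · rw [hu.2 i (mem_insert_of_mem hi'), zero_mul]
    · rw [hv.1 i hi', mul_zero]

/-- `W` is nonsingular but bordering it by `x` makes it singular. -/
def SingularBorder (p : ℕ) [Fact p.Prime] (x : ι) (W : Finset ι) (ω : Sym2 ι → ℤˣ) : Prop :=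
  ker p ω W = ⊥ ∧ ker p ω (insert x W) ≠ ⊥

lemma exists_singularBorder {ω : Sym2 ι → ℤˣ} {W : Finset ι} {x : ι} (h1 : ker p ω W ≠ ⊥)
    (h2 : ker p ω (insert x W) = ⊥) : ∃ y ∈ W, SingularBorder p y (W.erase y) ω := by
  obtain ⟨v, hv, hv0⟩ := Submodule.exists_mem_ne_zero_of_ne_bot h1
  obtain ⟨y, hy⟩ := Function.ne_iff.1 hv0
  have hyW : y ∈ W := by by_contra h; exact hy (hv.1 y h)
  have hins : ∀ u ∈ ker p ω W, rowSum ω u x = 0 → u = 0 := by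
    intro u hu hux
    rw [← Submodule.mem_bot (ZMod p), ← h2]
    exact ⟨fun i hi => hu.1 i fun h => hi (mem_insert_of_mem h),
      fun i hi => (mem_insert.1 hi).elim (fun h => h ▸ hux) (hu.2 i)⟩
  have hvx : rowSum ω v x ≠ 0 := fun h => hv0 (hins v hv h)
  refine ⟨y, hyW, ?_, by rwa [insert_erase hyW]⟩
  rw [Submodule.eq_bot_iff]
  intro u hu
  have huy : u y = 0 := hu.1 y (by simp)
  have h := sum_rowSum_mul_comm ω v u
  rw [sum_eq_zero fun i _ => ?_, sum_eq_single y (fun i _ hi => ?_) (by simp)] at h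
  · have huW : u ∈ ker p ω W := by
      refine ⟨fun i hi => hu.1 i fun h => hi (mem_of_mem_erase h), fun i hi => ?_⟩
      by_cases hiy : i = y
      · subst hiy
        exact (mul_eq_zero.1 h.symm).resolve_right hy
      · exact hu.2 i (mem_erase.2 ⟨hiy, hi⟩)
    have hw := hins (u - (rowSum ω u x / rowSum ω v x) • v)
      (Submodule.sub_mem _ huW (Submodule.smul_mem _ _ hv)) (by
        rw [rowSum_sub, rowSum_smul, div_mul_cancel₀ _ hvx, sub_self])
    have hwy := congrFun hw y
    rw [Pi.sub_apply, Pi.smul_apply, huy, smul_eq_mul, zero_sub, Pi.zero_apply,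
      neg_eq_zero] at hwy
    rw [(mul_eq_zero.1 hwy).resolve_right hy, zero_smul, sub_zero] at hw
    exact hw
  · by_cases hi' : i ∈ W
    · rw [hu.2 i (mem_erase.2 ⟨hi, hi'⟩), zero_mul]
    · rw [hv.1 i hi', mul_zero]
  · by_cases hi' : i ∈ W
    · rw [hv.2 i hi', zero_mul]
    · rw [hu.1 i fun h => hi' (mem_of_mem_erase h), mul_zero]

/-- The solution of the bordered system. -/
lemma SingularBorder.exists_solution {ω : Sym2 ι → ℤˣ} {W : Finset ι} {x : ι} (hx : x ∉ W)
    (h : SingularBorder p x W ω) :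
    ∃ y : ι → ZMod p, (∀ i ∉ W, y i = 0) ∧ (∀ i ∈ W, rowSum ω y i = entry p ω i x) ∧
      rowSum ω y x = entry p ω x x := by
  obtain ⟨u, hu, hu0⟩ := Submodule.exists_mem_ne_zero_of_ne_bot h.2
  have hux : u x ≠ 0 := by
    intro hux
    have : u ∈ ker p ω W := by
      refine ⟨fun i hi => ?_, fun i hi => hu.2 i (mem_insert_of_mem hi)⟩
      by_cases hix : i = x
      · rw [hix, hux]
      · exact hu.1 i (by simp [hix, hi])
    rw [h.1, Submodule.mem_bot] at this
    exact hu0 this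
  have hrow : ∀ i ∈ insert x W,
      rowSum ω (Pi.single x 1 - (u x)⁻¹ • u) i = entry p ω i x := fun i hi => by
    rw [rowSum_sub, rowSum_smul, rowSum_single, hu.2 i hi, mul_zero, sub_zero]
  refine ⟨Pi.single x 1 - (u x)⁻¹ • u, fun i hi => ?_,
    fun i hi => hrow i (mem_insert_of_mem hi), hrow x (mem_insert_self _ _)⟩
  by_cases hix : i = x
  · subst hix
    simp [hux]
  · simp [hix, hu.1 i (by simp [hix, hi])]

lemma rowSum_piecewise_of_eq_zero {x i : ι} (hix : i ≠ x) (U : Finset ι) (ω ω' : Sym2 ι → ℤˣ)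
    {v : ι → ZMod p} (hv : v x = 0) :
    rowSum ((star x U).piecewise ω' ω) v i = rowSum ω v i := by
  refine sum_congr rfl fun j _ => ?_
  by_cases hj : j = x
  · rw [hj, hv, mul_zero, mul_zero]
  · have : s(i, j) ∉ star x U := by rw [mk_mem_star_of_ne hix]; tauto
    simp [entry, this]

lemma mem_ker_piecewise {x : ι} {W : Finset ι} (hx : x ∉ W) (U : Finset ι)
    (ω ω' : Sym2 ι → ℤˣ) {v : ι → ZMod p} :
    v ∈ ker p ((star x U).piecewise ω' ω) W ↔ v ∈ ker p ω W := by
  refine and_congr_right fun hv => forall₂_congr fun i hi => ?_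
  rw [rowSum_piecewise_of_eq_zero (ne_of_mem_of_not_mem hi hx) U ω ω' (hv x hx)]

/-- Decoupling: the difference of the two bordered solutions is annihilated by the sum of the two
border rows. -/
lemma SingularBorder.exists_decoupled {ω ω' : Sym2 ι → ℤˣ} {W J : Finset ι} {x : ι} (hx : x ∉ W)
    (h : SingularBorder p x W ω)
    (h' : SingularBorder p x W ((star x J).piecewise ω' ω)) :
    ∃ w : ι → ZMod p, (∀ i ∉ W, w i = 0) ∧
      ∀ i ∈ W, rowSum ω w i = entry p ω x i - entry p ((star x J).piecewise ω' ω) x i := by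
  obtain ⟨y, hy, hyW, -⟩ := h.exists_solution hx
  obtain ⟨y', hy', hyW', -⟩ := h'.exists_solution hx
  refine ⟨y - y', fun i hi => by simp [hy i hi, hy' i hi], fun i hi => ?_⟩
  rw [rowSum_sub, hyW i hi, ← rowSum_piecewise_of_eq_zero (ne_of_mem_of_not_mem hi hx) J ω ω'
    (hy' x hx), hyW' i hi, entry_comm ω x, entry_comm _ x]

lemma SingularBorder.rowSum_add_rowSum_eq_zero {ω ω' : Sym2 ι → ℤˣ} {W J : Finset ι} {x : ι}
    (hx : x ∉ W) (hJ : J ⊆ W) (h : SingularBorder p x W ω)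
    (h' : SingularBorder p x W ((star x J).piecewise ω' ω)) {w : ι → ZMod p}
    (hw : ∀ i ∉ W, w i = 0)
    (hwW : ∀ i ∈ W, rowSum ω w i = entry p ω x i - entry p ((star x J).piecewise ω' ω) x i) :
    rowSum ω w x + rowSum ((star x J).piecewise ω' ω) w x = 0 := by
  set ω₁ := (star x J).piecewise ω' ω with hω₁
  obtain ⟨y, hy, hyW, hyx⟩ := h.exists_solution hx
  obtain ⟨y', hy', hyW', hyx'⟩ := h'.exists_solution hx
  have hrow : ∀ i ∈ W, ∀ v : ι → ZMod p, v x = 0 → rowSum ω₁ v i = rowSum ω v i :=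
    fun i hi v hv => rowSum_piecewise_of_eq_zero (ne_of_mem_of_not_mem hi hx) J ω ω' hv
  have hwy : w = y - y' := by
    rw [← sub_eq_zero, ← Submodule.mem_bot (ZMod p), ← h.1]
    refine ⟨fun i hi => by simp [hw i hi, hy i hi, hy' i hi], fun i hi => ?_⟩
    rw [rowSum_sub, rowSum_sub, hwW i hi, hyW i hi, ← hrow i hi y' (hy' x hx), hyW' i hi,
      entry_comm, entry_comm ω₁, sub_self]
  have hcross : rowSum ω y' x = rowSum ω₁ y x := by
    have h1 : ∑ i, rowSum ω y i * y' i = rowSum ω y' x := by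
      refine sum_congr rfl fun i _ => ?_
      by_cases hi : i ∈ W
      · rw [hyW i hi, entry_comm]
      · rw [hy' i hi, mul_zero, mul_zero]
    have h2 : ∑ i, rowSum ω y' i * y i = rowSum ω₁ y x := by
      refine sum_congr rfl fun i _ => ?_
      by_cases hi : i ∈ W
      · rw [← hrow i hi y' (hy' x hx), hyW' i hi, entry_comm]
      · rw [hy i hi, mul_zero, mul_zero]
    rw [← h1, ← h2, sum_rowSum_mul_comm]
  have hdiag : entry p ω₁ x x = entry p ω x x := by
    have : s(x, x) ∉ star x J := by
      rw [mk_mem_star]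
      exact fun h => hx (hJ h)
    simp [entry, hω₁, this]
  rw [hwy, rowSum_sub, rowSum_sub, hyx, hyx', hcross, hdiag]
  ring

end Kernel

section Steps

variable {p : ℕ} [Fact p.Prime] {ι : Type*} [Fintype ι] [DecidableEq ι]

/-- Some nonzero vector supported in `W` and of concentration at least `β` solves the linear
system with right-hand side `z`. -/
def Structured (β : ℝ) (W J : Finset ι) (z : ι → ZMod p) (ω : Sym2 ι → ℤˣ) : Prop :=
  ∃ v : ι → ZMod p, v ≠ 0 ∧ (∀ x ∉ W, v x = 0) ∧ (∀ i ∈ W, rowSum ω v i = z i) ∧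
    β ≤ conc v (W \ J)

/-- The probability that a new row annihilates a nontrivial kernel. -/
lemma prob_forall_ker_le (hp2 : p ≠ 2) {W J : Finset ι} {x : ι} (hx : x ∉ W) {β S : ℝ}
    (hβ : 0 ≤ β) (hS : ∀ z : ι → ZMod p, prob (Structured β W J z) ≤ S) :
    prob (fun ω => ker p ω W ≠ ⊥ ∧ ∀ v ∈ ker p ω W, rowSum ω v x = 0) ≤ S + β := by
  let A : (Sym2 ι → ℤˣ) → Prop := fun ω => ∃ v ∈ ker p ω W, v ≠ 0 ∧ conc v (W \ J) < β
  let B : (Sym2 ι → ℤˣ) → Prop := fun ω => ∀ v ∈ ker p ω W, rowSum ω v x = 0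
  have hAB : prob (fun ω => A ω ∧ B ω) ≤ β * prob A := by
    refine prob_and_le_mul (E := star x (W \ J)) (fun ω ω' => ?_) fun ω ⟨v, hv, _, hβv⟩ => ?_
    · simp only [A, mem_ker_piecewise hx]
    · refine (prob_mono fun ω' h => h v ((mem_ker_piecewise hx _ _ _).2 hv)).trans
        ((prob_rowSum_piecewise_le hp2 x _ v ω 0).trans hβv.le)
  calc _ ≤ prob (fun ω => Structured β W J (0 : ι → ZMod p) ω ∨ (A ω ∧ B ω)) := by
        refine prob_mono fun ω ⟨h, hB⟩ => ?_
        obtain ⟨v, hv, hv0⟩ := Submodule.exists_mem_ne_zero_of_ne_bot h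
        by_cases hβv : β ≤ conc v (W \ J)
        · exact Or.inl ⟨v, hv0, hv.1, hv.2, hβv⟩
        · exact Or.inr ⟨⟨v, hv, hv0, not_le.1 hβv⟩, hB⟩
    _ ≤ S + β * 1 := (prob_or_le _ _).trans (add_le_add (hS 0) (hAB.trans
        (mul_le_mul_of_nonneg_left (prob_le_one _) hβ)))
    _ = S + β := by rw [mul_one]

/-- The probability that the entries `(x, j)` with `j ∈ J` are prescribed. -/
lemma prob_forall_eq_le (x : ι) (J : Finset ι) (ω' : Sym2 ι → ℤˣ) :
    prob (fun ω : Sym2 ι → ℤˣ => ∀ j ∈ J, ω s(x, j) = ω' s(x, j)) ≤ (1 / 2) ^ #J := by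
  induction J using Finset.induction_on with
  | empty => simpa using prob_le_one _
  | insert r S hr ih =>
    have h := prob_and_le_mul (E := {s(x, r)}) (ρ := 1 / 2)
      (A := fun ω : Sym2 ι → ℤˣ => ∀ j ∈ S, ω s(x, j) = ω' s(x, j))
      (B := fun ω : Sym2 ι → ℤˣ => ω s(x, r) = ω' s(x, r)) (fun ω η => ?_) fun ω _ => ?_
    · rw [card_insert_of_notMem hr, pow_succ']
      refine le_trans (prob_mono fun ω h => ?_)
        (h.trans (mul_le_mul_of_nonneg_left ih (by norm_num)))
      exact ⟨fun j hj => h j (mem_insert_of_mem hj), h r (mem_insert_self _ _)⟩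
    · refine forall₂_congr fun j hj => ?_
      have : s(x, j) ≠ s(x, r) := fun h => hr (mk_injective x h ▸ hj)
      rw [piecewise_eq_of_notMem _ _ _ (by simpa using this)]
    · simp only [piecewise_singleton, Function.update_self, prob]
      rw [expect_eval s(x, r) fun b => if b = ω' s(x, r) then (1 : ℝ) else 0,
        Fintype.expect_eq_sum_div_card]
      simp [Int.units_eq_one_or]

omit [Fintype ι] [DecidableEq ι] in
lemma entry_injective (hp2 : p ≠ 2) {ω ω' : Sym2 ι → ℤˣ} {i j : ι}
    (h : entry p ω i j = entry p ω' i j) : ω s(i, j) = ω' s(i, j) := by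
  have h2 : (2 : ZMod p) ≠ 0 := Ring.two_ne_zero (by rwa [ZMod.ringChar_zmod_n])
  unfold entry at h
  rcases Int.units_eq_one_or (ω s(i, j)) with h1 | h1 <;>
    rcases Int.units_eq_one_or (ω' s(i, j)) with h3 | h3 <;> simp only [h1, h3] at h ⊢
  · exact absurd (by push_cast at h; linear_combination h) h2
  · exact absurd (by push_cast at h; linear_combination -h) h2

/-- The difference of the old and the resampled border row. -/
def borderDiff (p : ℕ) (x : ι) (J : Finset ι) (ω' ω : Sym2 ι → ℤˣ) (i : ι) : ZMod p :=
  entry p ω x i - entry p ((star x J).piecewise ω' ω) x i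

omit [Fintype ι] in
lemma borderDiff_of_notMem {x i : ι} {J : Finset ι} (hi : i ∉ J) (ω' ω : Sym2 ι → ℤˣ) :
    borderDiff p x J ω' ω i = 0 := by
  simp [borderDiff, entry, mk_mem_star, hi]

omit [Fintype ι] in
lemma borderDiff_of_mem {x i : ι} {J : Finset ι} (hi : i ∈ J) (ω' ω : Sym2 ι → ℤˣ) :
    borderDiff p x J ω' ω i = entry p ω x i - entry p ω' x i := by
  simp [borderDiff, entry, mk_mem_star, hi]

/-- The structured part of the decoupled event. -/
lemma prob_structured_borderDiff_le {W J : Finset ι} {x : ι} (hx : x ∉ W) {β S : ℝ}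
    (hS : ∀ z : ι → ZMod p, prob (Structured β W J z) ≤ S) (ω' : Sym2 ι → ℤˣ) :
    prob (fun ω => Structured β W J (borderDiff p x J ω' ω) ω) ≤ S := by
  refine prob_le_of_resample (E := (star x J)ᶜ) fun ω => ?_
  refine le_trans (prob_mono fun η ⟨v, hv0, hv, hvW, hβ⟩ => ?_) (hS (borderDiff p x J ω' ω))
  rw [piecewise_compl] at hvW
  refine ⟨v, hv0, hv, fun i hi => ?_, hβ⟩
  rw [← rowSum_piecewise_of_eq_zero (ne_of_mem_of_not_mem hi hx) J η ω (hv x hx), hvW i hi]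
  by_cases hiJ : i ∈ J
  · simp [borderDiff_of_mem hiJ, entry, mk_mem_star, hiJ]
  · simp [borderDiff_of_notMem hiJ]

/-- The unstructured part of the decoupled event. -/
lemma prob_unstructured_borderDiff_le (hp2 : p ≠ 2) {W J : Finset ι} {x : ι} (hx : x ∉ W)
    {β : ℝ} (hβ : 0 ≤ β) (ω' : Sym2 ι → ℤˣ) :
    prob (fun ω => (∃ w : ι → ZMod p, ((∀ i ∉ W, w i = 0) ∧
        ∀ i ∈ W, rowSum ω w i = borderDiff p x J ω' ω i) ∧ conc w (W \ J) < β) ∧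
      ∀ w : ι → ZMod p, ((∀ i ∉ W, w i = 0) ∧
        ∀ i ∈ W, rowSum ω w i = borderDiff p x J ω' ω i) →
          rowSum ω w x + rowSum ((star x J).piecewise ω' ω) w x = 0) ≤ β := by
  have h2 : (2 : ZMod p) ≠ 0 := Ring.two_ne_zero (by rwa [ZMod.ringChar_zmod_n])
  have hinv : ∀ (ω η : Sym2 ι → ℤˣ) (w : ι → ZMod p),
      ((∀ i ∉ W, w i = 0) ∧ ∀ i ∈ W, rowSum ((star x (W \ J)).piecewise η ω) w i =
        borderDiff p x J ω' ((star x (W \ J)).piecewise η ω) i) ↔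
      ((∀ i ∉ W, w i = 0) ∧ ∀ i ∈ W, rowSum ω w i = borderDiff p x J ω' ω i) := by
    intro ω η w
    refine and_congr_right fun hw => forall₂_congr fun i hi => ?_
    rw [rowSum_piecewise_of_eq_zero (ne_of_mem_of_not_mem hi hx) _ ω η (hw x hx)]
    by_cases hiJ : i ∈ J
    · simp [borderDiff_of_mem hiJ, entry, mk_mem_star, hiJ]
    · simp [borderDiff_of_notMem hiJ]
  refine le_trans (prob_and_le_mul (E := star x (W \ J)) (ρ := β) (fun ω η => ?_)
    fun ω ⟨w, hw, hwβ⟩ => ?_) (mul_le_of_le_one_right hβ (prob_le_one _))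
  · simp only [hinv]
  · refine le_trans (prob_mono fun η h => ?_) ((prob_partial_row_le hp2 x (W \ J) w
      (-(∑ j ∈ (W \ J)ᶜ, entry p ω x j * w j +
        ∑ j ∈ (W \ J)ᶜ, entry p ((star x J).piecewise ω' ω) x j * w j) / 2)).trans hwβ.le)
    have hsum := h w ((hinv ω η w).2 hw)
    have hcomm : (star x J).piecewise ω' ((star x (W \ J)).piecewise η ω) =
        (star x (W \ J)).piecewise η ((star x J).piecewise ω' ω) := by
      ext1 s
      by_cases h1 : s ∈ star x J <;> by_cases h3 : s ∈ star x (W \ J) <;> simp [h1, h3]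
      rw [star, mem_image] at h1
      obtain ⟨j, hj, rfl⟩ := h1
      rw [mk_mem_star, mem_sdiff] at h3
      exact absurd hj h3.2
    rw [hcomm, rowSum_piecewise, rowSum_piecewise] at hsum
    rw [eq_div_iff h2]
    linear_combination hsum

/-- The probability that a border makes the matrix singular. -/
lemma sq_prob_singularBorder_le (hp2 : p ≠ 2) {W J : Finset ι} {x : ι} (hx : x ∉ W) (hJ : J ⊆ W)
    {β S : ℝ} (hβ : 0 ≤ β) (hS : ∀ z : ι → ZMod p, prob (Structured β W J z) ≤ S) :
    prob (SingularBorder p x W) ^ 2 ≤ (1 / 2) ^ #J + S + β := by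
  refine (sq_prob_le_resample (star x J) _).trans ?_
  unfold prob
  rw [expect_comm]
  refine (expect_le_expect fun ω' _ => ?_).trans_eq (expect_const univ_nonempty _)
  refine le_trans (prob_mono fun ω ⟨h, h'⟩ => ?_) ((prob_or_le _ _).trans (add_le_add
    ((prob_or_le _ _).trans (add_le_add (prob_forall_eq_le x J ω')
      (prob_structured_borderDiff_le hx hS ω'))) (prob_unstructured_borderDiff_le (J := J) hp2 hx hβ ω')))
  obtain ⟨w, hw, hwW⟩ := h.exists_decoupled hx h'
  by_cases hw0 : w = 0
  · refine Or.inl (Or.inl fun j hj => entry_injective (p := p) hp2 ?_)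
    have := hwW j (hJ hj)
    rw [hw0, ← borderDiff, borderDiff_of_mem hj] at this
    rw [← sub_eq_zero, ← this]
    simp [rowSum]
  by_cases hwβ : β ≤ conc w (W \ J)
  · exact Or.inl (Or.inr ⟨w, hw0, hw, hwW, hwβ⟩)
  · exact Or.inr ⟨⟨w, ⟨hw, hwW⟩, not_le.1 hwβ⟩,
      fun u ⟨hu, huW⟩ => h.rowSum_add_rowSum_eq_zero hx hJ h' hu huW⟩

end Steps

section Chain

variable {p : ℕ} [Fact p.Prime] {ι : Type*} [Fintype ι] [DecidableEq ι]

/-- Along an increasing chain of index sets, a kernel either dies or is annihilated by a row. -/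
lemma exists_degenerate_step {ω : Sym2 ι → ℤˣ} (W : ℕ → Finset ι) (x : ℕ → ι) (k : ℕ)
    (hW : ∀ m < k, W (m + 1) = insert (x m) (W m)) (hk : #(W 0) ≤ k)
    (h0 : ker p ω (W 0) ≠ ⊥) :
    ∃ m < k, (ker p ω (W m) ≠ ⊥ ∧ ∀ v ∈ ker p ω (W m), rowSum ω v (x m) = 0) ∨
      ∃ y ∈ W m, SingularBorder p y ((W m).erase y) ω := by
  by_contra! h
  have key : ∀ m ≤ k, ker p ω (W m) ≠ ⊥ ∧ Module.finrank (ZMod p) (ker p ω (W m)) + m ≤ k := by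
    intro m
    induction m with
    | zero => exact fun _ => ⟨h0, (finrank_ker_le ω _).trans hk⟩
    | succ m ih =>
      intro hm
      obtain ⟨h1, h2⟩ := ih (by omega)
      obtain ⟨h3, h4⟩ := h m (by omega)
      obtain ⟨v, hv, hvx⟩ := h3 h1
      rw [hW m (by omega)]
      have hlt := Submodule.finrank_lt_finrank_of_lt (ker_insert_lt hv hvx)
      refine ⟨fun hbot => ?_, by omega⟩
      obtain ⟨y, hy, hyW⟩ := exists_singularBorder h1 hbot
      exact h4 y hy hyW
  obtain ⟨h1, h2⟩ := key k le_rfl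
  have h3 : Module.finrank (ZMod p) (ker p ω (W k)) = 0 := by omega
  exact h1 (Submodule.finrank_eq_zero.1 h3)

/-- The probability that the leading principal `n × n` submatrix is singular modulo `p`. -/
lemma prob_ker_ne_bot_le (hp2 : p ≠ 2) {n j : ℕ} {β S : ℝ} (hβ : 0 ≤ β)
    (hS : ∀ W : Finset (Fin (2 * n)), n - 1 ≤ #W → ∃ J ⊆ W, #J = j ∧
      ∀ z : Fin (2 * n) → ZMod p, prob (Structured β W J z) ≤ S) :
    prob (fun ω : Sym2 (Fin (2 * n)) → ℤˣ => ker p ω (univ.filter fun i => (i : ℕ) < n) ≠ ⊥) ≤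
      2 * n * (S + β + 2 * n * √((1 / 2) ^ j + S + β)) := by
  let K : Finset (Fin (2 * n)) := univ.filter fun i => n ≤ (i : ℕ)
  have hfail : ∀ x ∈ K, prob (fun ω => ker p ω (Iio x) ≠ ⊥ ∧
      ∀ v ∈ ker p ω (Iio x), rowSum ω v x = 0) ≤ S + β := by
    intro x hx
    rw [mem_filter] at hx
    obtain ⟨J, -, -, hJS⟩ := hS (Iio x) (by rw [Fin.card_Iio]; omega)
    exact prob_forall_ker_le hp2 (by simp) hβ hJS
  have hborder : ∀ x ∈ K, ∀ y ∈ Iio x, prob (SingularBorder p y ((Iio x).erase y)) ≤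
      √((1 / 2) ^ j + S + β) := by
    intro x hx y hy
    rw [mem_filter] at hx
    obtain ⟨J, hJ, rfl, hJS⟩ := hS ((Iio x).erase y)
      (by rw [card_erase_of_mem hy, Fin.card_Iio]; omega)
    exact Real.le_sqrt_of_sq_le (sq_prob_singularBorder_le hp2 (by simp) hJ hβ hJS)
  calc _ ≤ prob (fun ω => ∃ x ∈ K, (ker p ω (Iio x) ≠ ⊥ ∧
          ∀ v ∈ ker p ω (Iio x), rowSum ω v x = 0) ∨
          ∃ y ∈ Iio x, SingularBorder p y ((Iio x).erase y) ω) := by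
        refine prob_mono fun ω h => ?_
        rcases Nat.eq_zero_or_pos n with rfl | hn
        · refine absurd ?_ h
          rw [Submodule.eq_bot_iff]
          exact fun v _ => funext fun i => absurd i.2 (by simp)
        obtain ⟨m, hm, hmW⟩ := exists_degenerate_step
          (fun m => univ.filter fun i : Fin (2 * n) => (i : ℕ) < n + m)
          (fun m => if h : n + m < 2 * n then ⟨n + m, h⟩ else ⟨0, by omega⟩) n
          (fun m hm => by
            ext i
            rw [dif_pos (by omega)]
            simp only [mem_filter, mem_univ, true_and, mem_insert, Fin.ext_iff]
            omega)
          (by rw [Fin.card_filter_val_lt]; omega) h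
        have hm' : n + m < 2 * n := by omega
        have hI : (univ.filter fun i : Fin (2 * n) => (i : ℕ) < n + m) = Iio ⟨n + m, hm'⟩ := by
          ext i
          simp [Fin.lt_def]
        rw [dif_pos hm', hI] at hmW
        exact ⟨⟨n + m, hm'⟩, by simp [K], hmW⟩
    _ ≤ ∑ x ∈ K, (S + β + 2 * n * √((1 / 2) ^ j + S + β)) := by
        refine (prob_exists_le _ _).trans (sum_le_sum fun x hx => ?_)
        refine (prob_or_le _ _).trans (add_le_add (hfail x hx) ?_)
        refine (prob_exists_le _ _).trans ((sum_le_card_nsmul _ _ _ (hborder x hx)).trans ?_)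
        rw [nsmul_eq_mul, Fin.card_Iio]
        refine mul_le_mul_of_nonneg_right ?_ (Real.sqrt_nonneg _)
        exact_mod_cast x.2.le
    _ ≤ _ := by
        rw [sum_const, nsmul_eq_mul]
        have hK : (#K : ℝ) ≤ 2 * n := by
          exact_mod_cast (card_le_univ K).trans_eq (Fintype.card_fin _)
        refine mul_le_mul_of_nonneg_right hK ?_
        rcases Nat.eq_zero_or_pos n with rfl | hn
        · obtain ⟨J, -, -, hJS⟩ := hS ∅ (by simp)
          have := (prob_nonneg _).trans (hJS 0)
          positivity
        · obtain ⟨J, -, -, hJS⟩ := hS univ (by simp; omega)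
          have := (prob_nonneg _).trans (hJS 0)
          positivity

end Chain

section Transfer

/-- The symmetric matrix with sign pattern `ω`. -/
def symMatrix {n : ℕ} (ω : Sym2 (Fin n) → ℤˣ) : Matrix (Fin n) (Fin n) ℤ :=
  Matrix.of fun i j => (ω s(i, j) : ℤ)

lemma symMatrix_injective (n : ℕ) :
    Function.Injective (symMatrix : (Sym2 (Fin n) → ℤˣ) → Matrix (Fin n) (Fin n) ℤ) := by
  intro ω ω' h
  ext s
  induction s using Sym2.inductionOn with
  | hf i j => exact congrFun₂ h i j

lemma mem_range_symMatrix {n : ℕ} {A : Matrix (Fin n) (Fin n) ℤ} :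
    A ∈ Set.range symMatrix ↔ A.IsSymm ∧ ∀ i j, A i j = 1 ∨ A i j = -1 := by
  constructor
  · rintro ⟨ω, rfl⟩
    refine ⟨Matrix.IsSymm.ext fun i j => ?_, fun i j => ?_⟩
    · simp only [symMatrix, Matrix.of_apply, Sym2.eq_swap]
    · rcases Int.units_eq_one_or (ω s(i, j)) with h | h <;> simp [symMatrix, h]
  · rintro ⟨hA, h⟩
    have hu : ∀ i j, IsUnit (A i j) := fun i j => Int.isUnit_iff.2 (h i j)
    refine ⟨Sym2.lift ⟨fun i j => (hu i j).unit, fun i j => ?_⟩, ?_⟩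
    · ext
      simp [hA.apply]
    · ext i j
      simp [symMatrix]

lemma symPr_eq_prob (n : ℕ) (E : Set (Matrix (Fin n) (Fin n) ℤ)) :
    symPr n E = prob fun ω : Sym2 (Fin n) → ℤˣ => symMatrix ω ∈ E := by
  classical
  have h1 : {A : Matrix (Fin n) (Fin n) ℤ | (A.IsSymm ∧ ∀ i j, A i j = 1 ∨ A i j = -1) ∧ A ∈ E} =
      symMatrix '' {ω | symMatrix ω ∈ E} := by
    ext A
    simp only [← mem_range_symMatrix, Set.mem_ofPred_eq, Set.mem_image, Set.mem_range]
    constructor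
    · rintro ⟨⟨ω, rfl⟩, h⟩
      exact ⟨ω, h, rfl⟩
    · rintro ⟨ω, h, rfl⟩
      exact ⟨⟨ω, rfl⟩, h⟩
  have h2 : {A : Matrix (Fin n) (Fin n) ℤ | A.IsSymm ∧ ∀ i j, A i j = 1 ∨ A i j = -1} =
      symMatrix '' Set.univ := by
    ext A
    rw [Set.image_univ, mem_range_symMatrix, Set.mem_ofPred_eq]
  rw [symPr, h1, h2, Nat.card_image_of_injective (symMatrix_injective n),
    Nat.card_image_of_injective (symMatrix_injective n), prob, Fintype.expect_eq_sum_div_card,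
    sum_boole, Nat.card_univ, Nat.card_eq_fintype_card, Nat.card_eq_fintype_card]
  congr 2
  exact Fintype.card_subtype _

/-- A singular matrix is singular modulo `p`. -/
lemma ker_ne_bot_of_det_eq_zero {p n N : ℕ} [Fact p.Prime] (h : n ≤ N)
    (ω : Sym2 (Fin N) → ℤˣ) (hω : (symMatrix (ω ∘ Sym2.map (Fin.castLE h))).det = 0) :
    ker p ω (univ.filter fun i => (i : ℕ) < n) ≠ ⊥ := by
  have hdet : ((symMatrix (ω ∘ Sym2.map (Fin.castLE h))).map (Int.castRingHom (ZMod p))).det = 0 :=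
    by rw [← RingHom.mapMatrix_apply, ← RingHom.map_det, hω, map_zero]
  obtain ⟨v, hv0, hv⟩ := Matrix.exists_mulVec_eq_zero_iff.2 hdet
  have hinj := Fin.castLE_injective h
  have hrange : ∀ i : Fin N, (i : ℕ) < n → i ∈ Set.range (Fin.castLE h) :=
    fun i hi => ⟨⟨i, hi⟩, rfl⟩
  rw [Submodule.ne_bot_iff]
  refine ⟨Function.extend (Fin.castLE h) v 0, ⟨fun i hi => ?_, fun i hi => ?_⟩, fun h0 => hv0 ?_⟩
  · refine Function.extend_apply' _ _ _ ?_
    rintro ⟨a, rfl⟩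
    simp at hi
  · obtain ⟨a, rfl⟩ := hrange i (by simpa using hi)
    refine Eq.trans ?_ (congrFun hv a)
    rw [rowSum]
    refine (Fintype.sum_of_injective _ hinj _ _ (fun j hj => ?_) fun j => ?_).symm
    · rw [Function.extend_apply' _ _ _ hj, Pi.zero_apply, mul_zero]
    · simp [hinj.extend_apply, entry, symMatrix]
  · rw [← Function.extend_comp hinj v 0, h0]
    rfl

lemma symPr_det_le {p n N : ℕ} [Fact p.Prime] (h : n ≤ N) :
    symPr n {A | A.det = 0} ≤
      prob fun ω : Sym2 (Fin N) → ℤˣ => ker p ω (univ.filter fun i => (i : ℕ) < n) ≠ ⊥ := by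
  rw [symPr_eq_prob, prob,
    ← expect_comp_injective (Sym2.map.injective (Fin.castLE_injective h))]
  exact prob_mono fun ω hω => ker_ne_bot_of_det_eq_zero h ω hω

/-- The singularity probability in terms of the parameters of the argument. -/
lemma symPr_det_le_of_parameters {p n j l d : ℕ} [Fact p.Prime] (hp2 : p ≠ 2) {β : ℝ}
    (hl : (11 : ℝ) ≤ 2 ^ l) (hd : (15 / 16 : ℝ) ^ (d + 1) < β) (hpβ : 1 / (p : ℝ) ≤ β / 2 ^ l)
    (hn : 2 * (16 ^ l * d + j) + 2 * 16 ^ l + 1 ≤ n) {S : ℝ}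
    (hS : ∀ w, n - 1 ≤ w → w ≤ 2 * n → structuredBound (2 * n) w j d l p ≤ S) :
    symPr n {A | A.det = 0} ≤ 2 * n * (S + β + 2 * n * √((1 / 2) ^ j + S + β)) := by
  refine (symPr_det_le (p := p) (N := 2 * n) (by omega)).trans
    (prob_ker_ne_bot_le hp2 ((by positivity : (0 : ℝ) ≤ _).trans hd.le) fun W hW => ?_)
  have hWn : #W ≤ 2 * n := (card_le_univ W).trans_eq (Fintype.card_fin _)
  obtain ⟨J, hJ, hJj⟩ := exists_subset_card_eq (s := W) (n := j) (by omega)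
  refine ⟨J, hJ, hJj, fun z => ?_⟩
  refine (prob_structured_le hp2 hJ hl hd hpβ (by omega) (by omega) z).trans ?_
  rw [Fintype.card_fin, hJj]
  exact hS _ hW hWn

end Transfer

section Asymptotics

lemma pow_le_exp {a u s : ℝ} {k : ℕ} (ha : 0 ≤ a) (h : a ≤ Real.exp u) (hk : u * k ≤ s) :
    a ^ k ≤ Real.exp s := by
  refine (pow_le_pow_left₀ ha h k).trans ?_
  rw [← Real.exp_nat_mul, mul_comm]
  exact Real.exp_le_exp.2 hk

lemma exp_sub_two_le (b : ℝ) : Real.exp (-b - 2) ≤ Real.exp (-b) / 3 := by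
  rw [sub_eq_add_neg, Real.exp_add, div_eq_mul_inv, Real.exp_neg 2]
  gcongr
  have := Real.add_one_le_exp (2 : ℝ)
  linarith

set_option maxHeartbeats 400000 in
lemma structuredBound_le {n w j d l p t : ℕ} {b : ℝ} (hw : n - 1 ≤ w) (hw' : w ≤ 2 * n)
    (hlog : 5000 ≤ Real.log n) (hX : (11 / 2 ^ l : ℝ) ≤ Real.exp (-(Real.log n / 40)))
    (h16 : 16 ^ l ≤ n) (ht : t = 16 ^ l * d + 16 ^ l + j) (htn : t * Real.log n ≤ n / 1000)
    (hp : (p : ℝ) ≤ Real.exp (3 * b)) (hjd : (j + d : ℝ) ≤ 20 * b)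
    (hb : b ^ 2 ≤ n * Real.log n / 2 ^ 22) (hbn : b ≤ n / 1000) (hbt : b * (16 ^ l : ℕ) ≤ t) :
    structuredBound (2 * n) w j d l p ≤ Real.exp (-b) := by
  unfold structuredBound
  have hq1 : 0 < 16 ^ l := by positivity
  generalize 16 ^ l = q at *
  set ℓ := Real.log n with hℓ
  have hn0 : (0 : ℝ) < n := by
    rcases Nat.eq_zero_or_pos n with rfl | h
    · simp at hℓ; linarith
    · exact_mod_cast h
  have hexp : (n : ℝ) = Real.exp ℓ := (Real.exp_log hn0).symm
  have hn : (5000 : ℝ) ≤ n := by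
    rw [hexp]; linarith [Real.add_one_le_exp ℓ]
  have hb0 : 0 ≤ b := by
    have : (0 : ℝ) ≤ j + d := by positivity
    linarith
  have ht0 : (0 : ℝ) ≤ t := Nat.cast_nonneg t
  have htn' : (t : ℝ) ≤ n / 5000000 := by
    have := mul_le_mul_of_nonneg_left hlog ht0
    linarith
  have htN : 4 * t + 2 ≤ n := by
    have : (4 * t + 2 : ℝ) ≤ n := by linarith
    exact_mod_cast this
  have hnN : 5000 ≤ n := by exact_mod_cast hn
  have hcube : (n : ℝ) ^ 3 ≤ Real.exp (3 * ℓ) := by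
    rw [hexp, ← Real.exp_nat_mul]; norm_num
  have hsq : 5000 * n ^ 2 ≤ n ^ 3 := by
    rw [pow_succ' n 2]
    gcongr
  have hbase1 : (((2 * n) * (q + 1) + 1 : ℕ) : ℝ) ≤ Real.exp (3 * ℓ) := by
    refine le_trans ?_ hcube
    have : (2 * n) * (q + 1) + 1 ≤ n ^ 3 := by
      calc (2 * n) * (q + 1) + 1 ≤ (2 * n) * (n + 1) + 1 := by gcongr
        _ ≤ n ^ 3 := by nlinarith
    exact_mod_cast this
  have hbase2 : (((2 * n) * 3 + 1 : ℕ) : ℝ) ≤ Real.exp (3 * ℓ) := by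
    refine le_trans ?_ hcube
    have : (2 * n) * 3 + 1 ≤ n ^ 3 := by nlinarith
    exact_mod_cast this
  have h4 : (4 : ℝ) ≤ Real.exp 2 := by
    have := Real.add_one_le_exp (1 : ℝ)
    rw [show (2 : ℝ) = 1 + 1 by norm_num, Real.exp_add]
    nlinarith
  have h15 : (15 / 16 : ℝ) ≤ Real.exp (-(1 / 16)) := by
    have := Real.add_one_le_exp (-(1 / 16) : ℝ)
    linarith
  have hp0 : (0 : ℝ) ≤ p := Nat.cast_nonneg p
  have hX0 : (0 : ℝ) ≤ 11 / 2 ^ l := by positivity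
  have hpjd : (p : ℝ) ^ (j + d) ≤ Real.exp (60 * b ^ 2) := by
    refine pow_le_exp hp0 hp ?_
    push_cast
    nlinarith
  have hnℓ : 5000 * (n : ℝ) ≤ n * ℓ := by nlinarith
  have hℓ0 : 0 ≤ ℓ := by linarith
  -- comparison of exponents
  have hpoly : ∀ k : ℕ, k ≤ t → 3 * ℓ * k ≤ 3 * (n / 1000) := fun k hk => by
    have : (k : ℝ) ≤ t := by exact_mod_cast hk
    nlinarith
  have hgain : ∀ k : ℕ, n ≤ 2 * k → -(ℓ / 40) * k ≤ -(n * ℓ / 80) := fun k hk => by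
    have : (n : ℝ) ≤ 2 * k := by exact_mod_cast hk
    nlinarith
  have hkey : 3 * (n / 1000) + 60 * b ^ 2 + 4 * n ≤ n * ℓ / 80 - b - 2 := by
    linarith only [hb, hnℓ, hbn, hn]
  have T1 : (((2 * n) * (q + 1) + 1) ^ (q * d) : ℕ) *
      ((p : ℝ) ^ (j + d) * 4 ^ w * (11 / 2 ^ l : ℝ) ^ (w - j - q * d)) ≤
      Real.exp (-b) / 3 := by
    rw [Nat.cast_pow]
    calc _ ≤ Real.exp (3 * (n / 1000)) *
          (Real.exp (60 * b ^ 2) * Real.exp (4 * n) * Real.exp (-(n * ℓ / 80))) := by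
          gcongr
          · exact pow_le_exp (by positivity) hbase1 (hpoly _ (by omega))
          · refine pow_le_exp (by norm_num) h4 ?_
            have : (w : ℝ) ≤ 2 * n := by exact_mod_cast hw'
            linarith
          · exact pow_le_exp hX0 hX (hgain _ (by omega))
      _ ≤ Real.exp (-b - 2) := by
          rw [← Real.exp_add, ← Real.exp_add, ← Real.exp_add]
          exact Real.exp_le_exp.2 (by linarith only [hkey])
      _ ≤ _ := exp_sub_two_le b
  have T2 : (((2 * n) * 3 + 1) ^ (q * d + j) : ℕ) *
      ((11 / 2 ^ l : ℝ) ^ (w - 2 * (q * d + j)) *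
        ((p : ℝ) ^ (j + d) * 4 ^ (q * d + j))) ≤ Real.exp (-b) / 3 := by
    rw [Nat.cast_pow]
    calc _ ≤ Real.exp (3 * (n / 1000)) *
          (Real.exp (-(n * ℓ / 80)) * (Real.exp (60 * b ^ 2) * Real.exp (4 * n))) := by
          gcongr
          · exact pow_le_exp (by positivity) hbase2 (hpoly _ (by omega))
          · exact pow_le_exp hX0 hX (hgain _ (by omega))
          · refine pow_le_exp (by norm_num) h4 ?_
            have : ((q * d + j : ℕ) : ℝ) ≤ n := by
              exact_mod_cast (show q * d + j ≤ n by omega)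
            linarith
      _ ≤ Real.exp (-b - 2) := by
          rw [← Real.exp_add, ← Real.exp_add, ← Real.exp_add]
          exact Real.exp_le_exp.2 (by linarith only [hkey])
      _ ≤ _ := exp_sub_two_le b
  have T3 : (((2 * n) * 3 + 1) ^ q : ℕ) *
      ((15 / 16 : ℝ) ^ (w - 2 * q) * ((p : ℝ) ^ q * 4 ^ q)) ≤
      Real.exp (-b) / 3 := by
    rw [Nat.cast_pow]
    calc _ ≤ Real.exp (3 * (n / 1000)) *
          (Real.exp (-(n / 32)) * (Real.exp (3 * t) * Real.exp (2 * t))) := by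
          gcongr
          · exact pow_le_exp (by positivity) hbase2 (hpoly _ (by omega))
          · refine pow_le_exp (by norm_num) h15 ?_
            have : (n : ℝ) ≤ 2 * (w - 2 * q : ℕ) := by
              exact_mod_cast (show n ≤ 2 * (w - 2 * q) by omega)
            linarith
          · refine pow_le_exp hp0 hp ?_
            linarith
          · refine pow_le_exp (by norm_num) h4 ?_
            have : ((q : ℕ) : ℝ) ≤ t := by
              exact_mod_cast (show q ≤ t by omega)
            linarith
      _ ≤ Real.exp (-b - 2) := by
          rw [← Real.exp_add, ← Real.exp_add, ← Real.exp_add]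
          exact Real.exp_le_exp.2 (by linarith only [htn', hbn, hn])
      _ ≤ _ := exp_sub_two_le b
  linarith

/-- Choice of the scale `2 ^ l ≈ n ^ (1 / 16)`. -/
lemma exists_scale {n : ℕ} (hlog : 5000 ≤ Real.log n) : ∃ l : ℕ, (2 ^ l) ^ 16 ≤ n ∧
    (11 : ℝ) ≤ 2 ^ l ∧ (11 / 2 ^ l : ℝ) ≤ Real.exp (-(Real.log n / 40)) := by
  have hn : n ≠ 0 := by
    rintro rfl
    simp at hlog
    linarith
  set l := Nat.log 2 n / 16 with hl
  have h1 : (2 ^ l) ^ 16 ≤ n := by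
    rw [← pow_mul]
    exact (Nat.pow_le_pow_right (by norm_num) (by omega)).trans (Nat.pow_log_le_self 2 hn)
  have h2 : n ≤ 2 ^ (16 * (l + 1)) :=
    (Nat.lt_pow_succ_log_self (by norm_num) n).le.trans
      (Nat.pow_le_pow_right (by norm_num) (by omega))
  have h3 : Real.log n ≤ 16 * (l + 1) * Real.log 2 := by
    have h : (n : ℝ) ≤ 2 ^ (16 * (l + 1)) := by exact_mod_cast h2
    have := Real.log_le_log (by positivity) h
    rw [Real.log_pow] at this
    push_cast at this
    exact this
  have h4 : Real.exp (Real.log n / 20) ≤ 2 ^ l := by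
    rw [← Real.exp_log (show (0 : ℝ) < 2 ^ l by positivity), Real.exp_le_exp, Real.log_pow]
    linarith [Real.log_two_lt_d9]
  have h5 : (11 : ℝ) ≤ Real.exp (Real.log n / 40) := by
    linarith [Real.add_one_le_exp (Real.log n / 40)]
  refine ⟨l, h1, h5.trans ((Real.exp_le_exp.2 (by linarith)).trans h4), ?_⟩
  rw [div_le_iff₀ (by positivity)]
  refine (h5.trans_eq ?_).trans (mul_le_mul_of_nonneg_left h4 (Real.exp_pos _).le)
  rw [← Real.exp_add]
  congr 1
  ring

/-- Choice of the prime. -/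
lemma exists_prime_le_exp {b : ℝ} (hb : 2 ≤ b) :
    ∃ p : ℕ, p.Prime ∧ p ≠ 2 ∧ Real.exp (2 * b) ≤ p ∧ (p : ℝ) ≤ Real.exp (3 * b) := by
  have h3 : 3 ≤ Real.exp b := by linarith [Real.add_one_le_exp b]
  have h4 : 4 ≤ Real.exp b := by
    have h := Real.add_one_le_exp (1 : ℝ)
    have : Real.exp 1 * Real.exp 1 ≤ Real.exp b := by
      rw [← Real.exp_add]
      exact Real.exp_le_exp.2 (by linarith)
    nlinarith
  have h2 : Real.exp (2 * b) = Real.exp b ^ 2 := by rw [← Real.exp_nat_mul]; norm_num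
  have h3b : Real.exp (3 * b) = Real.exp b ^ 3 := by rw [← Real.exp_nat_mul]; norm_num
  have hceil := Nat.le_ceil (Real.exp (2 * b))
  have hceil' := Nat.ceil_lt_add_one (Real.exp_pos (2 * b)).le
  obtain ⟨p, hp, hlt, hle⟩ :=
    Nat.exists_prime_lt_and_le_two_mul ⌈Real.exp (2 * b)⌉₊ (by positivity)
  have hlt' : (⌈Real.exp (2 * b)⌉₊ : ℝ) < p := by exact_mod_cast hlt
  have hle' : (p : ℝ) ≤ 2 * ⌈Real.exp (2 * b)⌉₊ := by exact_mod_cast hle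
  refine ⟨p, hp, ?_, by linarith, ?_⟩
  · rintro rfl
    push_cast at hlt'
    nlinarith
  · rw [h3b]
    nlinarith

lemma symPr_det_le_exp {n : ℕ} (hlog : 5000 ≤ Real.log n)
    (hbig : 10 ^ 5 * Real.log n ^ 6 ≤ n) :
    symPr n {A | A.det = 0} ≤
      Real.exp (-((2 : ℝ) ^ (-13 : ℤ)) * Real.sqrt (n * Real.log n)) := by
  set ℓ := Real.log n with hℓ
  have hn0 : (0 : ℝ) < n := lt_of_lt_of_le (by positivity) hbig
  have hℓn : 10 ^ 5 * 5000 ^ 5 * ℓ ≤ n := by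
    have : (5000 : ℝ) ^ 5 * ℓ ≤ ℓ ^ 6 := by
      rw [pow_succ ℓ 5]
      gcongr
    linarith
  set b := √(n * ℓ) / 2048 with hb
  have hb2 : b ^ 2 = n * ℓ / 2 ^ 22 := by
    rw [hb, div_pow, Real.sq_sqrt (by positivity)]
    norm_num
  have hb0 : 0 ≤ b := by positivity
  have hbℓ : 100 * ℓ ≤ b := by
    refine le_of_sq_le_sq ?_ hb0
    nlinarith
  have hbn : b ≤ n / 1000 := by
    refine le_of_sq_le_sq ?_ (by positivity)
    nlinarith
  obtain ⟨l, hl16, hl11, hX⟩ := exists_scale hlog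
  obtain ⟨p, hp, hp2, hpl, hpu⟩ := exists_prime_le_exp (b := b) (by linarith)
  have : Fact p.Prime := ⟨hp⟩
  set j := ⌈2 * b⌉₊
  set d := ⌊16 * b⌋₊
  have hj : 2 * b ≤ j := Nat.le_ceil _
  have hj' : (j : ℝ) < 2 * b + 1 := Nat.ceil_lt_add_one (by positivity)
  have hd : 16 * b < d + 1 := Nat.lt_floor_add_one _
  have hd' : (d : ℝ) ≤ 16 * b := Nat.floor_le (by positivity)
  have h16 : 16 ^ l = (2 ^ l) ^ 4 := by rw [← pow_mul, mul_comm, pow_mul]; norm_num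
  have hQ4 : ((16 ^ l : ℕ) : ℝ) ^ 4 ≤ n := by
    rw [h16]
    exact_mod_cast (by rwa [← pow_mul] : ((2 ^ l) ^ 4) ^ 4 ≤ n)
  have hQ1 : (1 : ℝ) ≤ (16 ^ l : ℕ) := by exact_mod_cast Nat.one_le_pow _ _ (by norm_num)
  have h16n : 16 ^ l ≤ n := by
    have : ((16 ^ l : ℕ) : ℝ) ≤ n := (le_self_pow₀ hQ1 (by norm_num)).trans hQ4
    exact_mod_cast this
  have h2l : (2 : ℝ) ^ l ≤ Real.exp b := by
    have h1 : (2 : ℝ) ^ l ≤ n := by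
      exact_mod_cast (Nat.le_self_pow (by norm_num) (2 ^ l)).trans hl16
    rw [← Real.exp_log hn0] at h1
    exact h1.trans (Real.exp_le_exp.2 (by linarith))
  have htb : ((16 ^ l * d + 16 ^ l + j : ℕ) : ℝ) ≤ 20 * (16 ^ l : ℕ) * b := by
    rw [Nat.cast_add, Nat.cast_add, Nat.cast_mul]
    nlinarith
  have htn : ((16 ^ l * d + 16 ^ l + j : ℕ) : ℝ) * ℓ ≤ n / 1000 := by
    refine (mul_le_mul_of_nonneg_right htb (by linarith)).trans ?_
    refine le_of_pow_le_pow_left₀ (n := 4) (by norm_num) (by positivity) ?_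
    calc (20 * (16 ^ l : ℕ) * b * ℓ) ^ 4
        = 20 ^ 4 * ((16 ^ l : ℕ) : ℝ) ^ 4 * (b ^ 2) ^ 2 * ℓ ^ 4 := by ring
      _ ≤ 20 ^ 4 * n * (n * ℓ / 2 ^ 22) ^ 2 * ℓ ^ 4 := by rw [hb2]; gcongr
      _ = n ^ 3 * (20 ^ 4 / 2 ^ 44 * ℓ ^ 6) := by ring
      _ ≤ n ^ 3 * (n / 1000 ^ 4) := by
          refine mul_le_mul_of_nonneg_left ?_ (by positivity)
          linarith
      _ = (n / 1000) ^ 4 := by ring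
  have hn : 2 * (16 ^ l * d + j) + 2 * 16 ^ l + 1 ≤ n := by
    have h1 := mul_le_mul_of_nonneg_left hlog (Nat.cast_nonneg (α := ℝ) (16 ^ l * d + 16 ^ l + j))
    have h2 : (2 * (16 ^ l * d + 16 ^ l + j : ℕ) + 1 : ℝ) ≤ n := by linarith
    have h3 : 2 * (16 ^ l * d + 16 ^ l + j) + 1 ≤ n := by exact_mod_cast h2
    omega
  have hdβ : (15 / 16 : ℝ) ^ (d + 1) < Real.exp (-b) := by
    refine lt_of_le_of_lt (pow_le_exp (u := -(1 / 16)) (by norm_num) ?_ le_rfl)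
      (Real.exp_lt_exp.2 ?_)
    · linarith [Real.add_one_le_exp (-(1 / 16) : ℝ)]
    · push_cast
      linarith
  have hjβ : (1 / 2 : ℝ) ^ j ≤ Real.exp (-b) := by
    refine pow_le_exp (u := -(1 / 2)) (by norm_num) ?_ (by linarith)
    linarith [Real.add_one_le_exp (-(1 / 2) : ℝ)]
  have hpβ : 1 / (p : ℝ) ≤ Real.exp (-b) / 2 ^ l := by
    rw [Real.exp_neg, div_eq_mul_inv _ ((2 : ℝ) ^ l), ← mul_inv, ← one_div]
    refine one_div_le_one_div_of_le (by positivity) (le_trans ?_ hpl)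
    rw [two_mul b, Real.exp_add]
    gcongr
  refine (symPr_det_le_of_parameters hp2 hl11 hdβ hpβ hn fun w hw hw' =>
    structuredBound_le hw hw' hlog hX h16n rfl htn hpu (by linarith) hb2.le hbn ?_).trans ?_
  · rw [Nat.cast_add, Nat.cast_add, Nat.cast_mul]
    nlinarith
  have hsqrt : √((1 / 2 : ℝ) ^ j + Real.exp (-b) + Real.exp (-b)) ≤ 2 * Real.exp (-(b / 2)) := by
    refine Real.sqrt_le_iff.2 ⟨by positivity, ?_⟩
    rw [mul_pow, ← Real.exp_nat_mul, show ((2 : ℕ) : ℝ) * -(b / 2) = -b by push_cast; ring]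
    linarith [Real.exp_pos (-b)]
  have hexp : Real.exp (-b) ≤ Real.exp (-(b / 2)) := Real.exp_le_exp.2 (by linarith)
  have hn1 : 12 ≤ (n : ℝ) := by linarith
  calc 2 * n * (Real.exp (-b) + Real.exp (-b) +
        2 * n * √((1 / 2 : ℝ) ^ j + Real.exp (-b) + Real.exp (-b)))
      ≤ 2 * n * (n * Real.exp (-(b / 2)) + n * Real.exp (-(b / 2)) +
        2 * n * (2 * Real.exp (-(b / 2)))) := by
        have : Real.exp (-b) ≤ n * Real.exp (-(b / 2)) := by nlinarith [Real.exp_pos (-(b / 2))]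
        gcongr
    _ = 12 * n ^ 2 * Real.exp (-(b / 2)) := by ring
    _ ≤ n ^ 3 * Real.exp (-(b / 2)) := by
        rw [pow_succ' _ 2]
        gcongr
    _ = Real.exp (3 * ℓ - b / 2) := by
        rw [← Real.exp_log hn0, ← Real.exp_nat_mul, ← Real.exp_add]
        congr 1
    _ ≤ _ := by
        refine Real.exp_le_exp.2 ?_
        rw [show -((2 : ℝ) ^ (-13 : ℤ)) * √(n * ℓ) = -(b / 4) by rw [hb]; norm_num; ring]
        linarith

end Asymptotics

end SymmetricSign

/-- **Theorem 1.1.** For `c = 2⁻¹³` and all sufficiently large `n`, the probability that a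
uniformly random `n × n` symmetric `±1` matrix is singular is at most `exp(-c√(n log n))`. -/
theorem singularity_prob_symmetric :
    ∃ N : ℕ, ∀ n : ℕ, N ≤ n →
      symPr n {A | A.det = 0} ≤
        Real.exp (-((2 : ℝ) ^ (-13 : ℤ)) * Real.sqrt (n * Real.log n)) := by
  have hlog : ∀ᶠ n : ℕ in Filter.atTop, 5000 ≤ Real.log n :=
    (Real.tendsto_log_atTop.comp tendsto_natCast_atTop_atTop).eventually_ge_atTop 5000
  have hbig : ∀ᶠ n : ℕ in Filter.atTop, 10 ^ 5 * Real.log n ^ 6 ≤ (n : ℝ) := by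
    have h := (Real.isLittleO_pow_log_id_atTop (n := 6)).comp_tendsto
      (tendsto_natCast_atTop_atTop (R := ℝ))
    filter_upwards [h.def (show (0 : ℝ) < 1 / 10 ^ 5 by norm_num)] with n hn
    simp only [Function.comp_apply, id_eq, Real.norm_eq_abs, Nat.abs_cast] at hn
    linarith [le_abs_self (Real.log n ^ 6)]
  obtain ⟨N, hN⟩ := Filter.eventually_atTop.1 (hlog.and hbig)
  exact ⟨N, fun n hn => SymmetricSign.symPr_det_le_exp (hN n hn).1 (hN n hn).2⟩
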